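/- arXiv:1906.11704 — 3 statements merged into one kernel-verified Lean document; each statement's English description precedes it below -/
import Mathlib

section
/- Vanishing of non-resonant oscillatory integrals: for every t ∈ [𝒯/ε, 2𝒯/ε] the iterated integral 𝓘(ε,t,x) is well defined (the inner integral is a function of ξ that is Lebesgue integrable on ℝ), and for every integer n ≥ 2 there exists a constant C_n > 0, independent of ε, t, x, such that |𝓘(ε,t,x)| ≤ C_n · r · 𝒯 · ε^{n − 1/2} · η^{1 − 4n} · (1 + B_n)^n · ‖a‖_{W^{n,∞}} for all ε ∈ (0,1], all t ∈ [𝒯/ε, 2𝒯/ε] and all x ∈ ℝ. -/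
open Real Filter Topology MeasureTheory Set

/-- The phase `Φ(t,x;s,y,ξ) = (s-t) p(ξ) + (x-y) ξ - ψ(s,y)`. -/
noncomputable def oscPhase (p : ℝ → ℝ) (ψ : ℝ × ℝ → ℝ) (t x s y ξ : ℝ) : ℝ :=
  (s - t) * p ξ + (x - y) * ξ - ψ (s, y)

/-- The inner integral `∫₀^t ∫_ℝ e^{-iΦ/ε} ζ(ξ) a(εs,s,y) dy ds`,
as a function of `ξ`. -/
noncomputable def oscInner (p : ℝ → ℝ) (ψ : ℝ × ℝ → ℝ) (ζ : ℝ → ℝ)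
    (a : ℝ × ℝ × ℝ → ℂ) (ε t x ξ : ℝ) : ℂ :=
  ∫ s in Set.Icc (0:ℝ) t, ∫ y : ℝ,
    Complex.exp (-(Complex.I * ((oscPhase p ψ t x s y ξ / ε : ℝ) : ℂ))) *
      ((ζ ξ : ℝ) : ℂ) * a (ε * s, s, y)

/-- The oscillatory integral `𝓘(ε,t,x)`. -/
noncomputable def oscIntegral (p : ℝ → ℝ) (ψ : ℝ × ℝ → ℝ) (ζ : ℝ → ℝ)
    (a : ℝ × ℝ × ℝ → ℂ) (ε t x : ℝ) : ℂ :=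
  ((Real.sqrt ε / (2 * Real.pi) : ℝ) : ℂ) * ∫ ξ : ℝ, oscInner p ψ ζ a ε t x ξ

/-- `B_n = sup_{2 ≤ |α| ≤ n} sup_{(t,x)} |∂^α ψ(t,x)|`, the at-most-quadratic
constants of the phase `ψ`. -/
noncomputable def quadConst (ψ : ℝ × ℝ → ℝ) (n : ℕ) : ℝ :=
  ⨆ k : Set.Icc (2:ℕ) n, ⨆ z : ℝ × ℝ, ‖iteratedFDeriv ℝ (k : ℕ) ψ z‖

/-- `‖a‖_{W^{n,∞}} = sup_{|α| ≤ n} sup |∂^α a|`. -/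
noncomputable def Wnorm (a : ℝ × ℝ × ℝ → ℂ) (n : ℕ) : ℝ :=
  ⨆ k : Fin (n + 1), ⨆ z : ℝ × ℝ × ℝ, ‖iteratedFDeriv ℝ (k : ℕ) a z‖


/-- Bounds of all derivatives up to order `N` of a family `f i`, on the sets `U i`, by constant
multiples of the weights `w i`, uniformly in the index `i`. -/
def SymbolBound {ι E : Type*} [NormedAddCommGroup E] [NormedSpace ℝ E] (U : ι → Set E) :
    ℕ → (ι → E → ℝ) → (ι → E → ℂ) → Prop
  | 0, w, f => ∃ C, 0 ≤ C ∧ ∀ i, ∀ z ∈ U i, ‖f i z‖ ≤ C * w i z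
  | N + 1, w, f => (∃ C, 0 ≤ C ∧ ∀ i, ∀ z ∈ U i, ‖f i z‖ ≤ C * w i z) ∧
      (∀ i, DifferentiableOn ℝ (f i) (U i)) ∧
      ∀ v : E, SymbolBound U N w (fun i z => fderiv ℝ (f i) z v)

namespace SymbolBound

variable {ι E : Type*} [NormedAddCommGroup E] [NormedSpace ℝ E] {U : ι → Set E}
  {w w' : ι → E → ℝ} {f g : ι → E → ℂ} {N : ℕ}

theorem bound (h : SymbolBound U N w f) :
    ∃ C, 0 ≤ C ∧ ∀ i, ∀ z ∈ U i, ‖f i z‖ ≤ C * w i z := by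
  cases N with
  | zero => exact h
  | succ N => exact h.1

theorem congr (hU : ∀ i, IsOpen (U i)) (h : SymbolBound U N w f)
    (hfg : ∀ i, EqOn (f i) (g i) (U i)) : SymbolBound U N w g := by
  have hb : ∃ C, 0 ≤ C ∧ ∀ i, ∀ z ∈ U i, ‖g i z‖ ≤ C * w i z := by
    obtain ⟨C, hC, hb⟩ := h.bound
    exact ⟨C, hC, fun i z hz => hfg i hz ▸ hb i z hz⟩
  induction N generalizing f g with
  | zero => exact hb
  | succ N ih =>
    refine ⟨hb, fun i => (h.2.1 i).congr fun z hz => (hfg i hz).symm, fun v => ?_⟩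
    have hd : ∀ i, EqOn (fun z => fderiv ℝ (f i) z v) (fun z => fderiv ℝ (g i) z v) (U i) := by
      intro i z hz
      have : f i =ᶠ[𝓝 z] g i := (hfg i).eventuallyEq_of_mem ((hU i).mem_nhds hz)
      simp only [this.fderiv_eq]
    refine ih (h.2.2 v) hd ?_
    obtain ⟨C, hC, hb⟩ := (h.2.2 v).bound
    exact ⟨C, hC, fun i z hz => (congrArg norm (hd i hz)).symm.trans_le (hb i z hz)⟩

theorem mono_weight (h : SymbolBound U N w f) {c : ℝ} (hc : 0 ≤ c)
    (hw : ∀ i, ∀ z ∈ U i, w i z ≤ c * w' i z) : SymbolBound U N w' f := by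
  have hb : ∃ C, 0 ≤ C ∧ ∀ i, ∀ z ∈ U i, ‖f i z‖ ≤ C * w' i z := by
    obtain ⟨C, hC, hb⟩ := h.bound
    refine ⟨C * c, by positivity, fun i z hz => (hb i z hz).trans ?_⟩
    rw [mul_assoc]
    exact mul_le_mul_of_nonneg_left (hw i z hz) hC
  induction N generalizing f with
  | zero => exact hb
  | succ N ih =>
    refine ⟨hb, h.2.1, fun v => ih (h.2.2 v) ?_⟩
    obtain ⟨C, hC, hb⟩ := (h.2.2 v).bound
    refine ⟨C * c, by positivity, fun i z hz => (hb i z hz).trans ?_⟩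
    rw [mul_assoc]
    exact mul_le_mul_of_nonneg_left (hw i z hz) hC

theorem of_succ (h : SymbolBound U (N + 1) w f) : SymbolBound U N w f := by
  induction N generalizing f with
  | zero => exact h.1
  | succ N ih => exact ⟨h.1, h.2.1, fun v => ih (h.2.2 v)⟩

theorem add (hU : ∀ i, IsOpen (U i)) (hf : SymbolBound U N w f) (hg : SymbolBound U N w g) :
    SymbolBound U N w (fun i z => f i z + g i z) := by
  have hb : ∀ {f g : ι → E → ℂ}, (∃ C, 0 ≤ C ∧ ∀ i, ∀ z ∈ U i, ‖f i z‖ ≤ C * w i z) →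
      (∃ C, 0 ≤ C ∧ ∀ i, ∀ z ∈ U i, ‖g i z‖ ≤ C * w i z) →
      ∃ C, 0 ≤ C ∧ ∀ i, ∀ z ∈ U i, ‖f i z + g i z‖ ≤ C * w i z := by
    rintro f g ⟨C, hC, hf⟩ ⟨C', hC', hg⟩
    refine ⟨C + C', by positivity, fun i z hz => (norm_add_le _ _).trans ?_⟩
    rw [add_mul]
    exact add_le_add (hf i z hz) (hg i z hz)
  induction N generalizing f g with
  | zero => exact hb hf hg
  | succ N ih =>
    refine ⟨hb hf.1 hg.1, fun i => (hf.2.1 i).add (hg.2.1 i), fun v => ?_⟩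
    refine (ih (hf.2.2 v) (hg.2.2 v)).congr hU fun i z hz => ?_
    have h1 := (hf.2.1 i).differentiableAt ((hU i).mem_nhds hz)
    have h2 := (hg.2.1 i).differentiableAt ((hU i).mem_nhds hz)
    simp only [fderiv_fun_add h1 h2, add_apply]

theorem mul (hU : ∀ i, IsOpen (U i)) (hw : ∀ i z, 0 ≤ w i z)
    (hf : SymbolBound U N w f) (hg : SymbolBound U N w' g) :
    SymbolBound U N (fun i z => w i z * w' i z) (fun i z => f i z * g i z) := by
  have hb : ∀ {f g : ι → E → ℂ}, (∃ C, 0 ≤ C ∧ ∀ i, ∀ z ∈ U i, ‖f i z‖ ≤ C * w i z) →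
      (∃ C, 0 ≤ C ∧ ∀ i, ∀ z ∈ U i, ‖g i z‖ ≤ C * w' i z) →
      ∃ C, 0 ≤ C ∧ ∀ i, ∀ z ∈ U i, ‖f i z * g i z‖ ≤ C * (w i z * w' i z) := by
    rintro f g ⟨C, hC, hf⟩ ⟨C', hC', hg⟩
    refine ⟨C * C', by positivity, fun i z hz => ?_⟩
    rw [norm_mul, mul_mul_mul_comm]
    exact mul_le_mul (hf i z hz) (hg i z hz) (norm_nonneg _) (mul_nonneg hC (hw i z))
  induction N generalizing f g with
  | zero => exact hb hf hg
  | succ N ih =>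
    refine ⟨hb hf.1 hg.1, fun i => (hf.2.1 i).mul (hg.2.1 i), fun v => ?_⟩
    refine ((ih hf.of_succ (hg.2.2 v)).add hU (ih (hf.2.2 v) hg.of_succ)).congr hU
      fun i z hz => ?_
    have h1 := (hf.2.1 i).differentiableAt ((hU i).mem_nhds hz)
    have h2 := (hg.2.1 i).differentiableAt ((hU i).mem_nhds hz)
    simp only [fderiv_fun_mul h1 h2, add_apply, smul_apply, smul_eq_mul]
    ring

theorem inv (hU : ∀ i, IsOpen (U i)) (hf : ∀ N, SymbolBound U N w f)
    (hw : ∀ i, ∀ z, 0 ≤ w i z)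
    (hlow : ∀ i, ∀ z ∈ U i, 0 < w i z ∧ w i z ≤ ‖f i z‖) (N : ℕ) :
    SymbolBound U N (fun i z => (w i z)⁻¹) (fun i z => (f i z)⁻¹) := by
  have hb : ∃ C, 0 ≤ C ∧ ∀ i, ∀ z ∈ U i, ‖(f i z)⁻¹‖ ≤ C * (w i z)⁻¹ := by
    refine ⟨1, zero_le_one, fun i z hz => ?_⟩
    rw [norm_inv, one_mul]
    exact inv_anti₀ (hlow i z hz).1 (hlow i z hz).2
  have hne : ∀ i, ∀ z ∈ U i, f i z ≠ 0 := fun i z hz =>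
    norm_pos_iff.1 ((hlow i z hz).1.trans_le (hlow i z hz).2)
  induction N with
  | zero => exact hb
  | succ N ih =>
    refine ⟨hb, fun i => ((hf 1).2.1 i).inv (hne i), fun v => ?_⟩
    have hconst : SymbolBound U N (fun _ _ => 1) (fun _ _ => (-1 : ℂ)) := by
      have : ∀ N (c : ℂ), SymbolBound U N (fun _ _ => 1) (fun _ _ => c) := by
        intro N
        induction N with
        | zero => exact fun c => ⟨‖c‖, norm_nonneg _, by simp⟩
        | succ N ih =>
          exact fun c => ⟨⟨‖c‖, norm_nonneg _, by simp⟩, fun i => differentiableOn_const c,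
            fun v => by simpa using ih 0⟩
      exact this N _
    have hinv : ∀ i z, 0 ≤ (w i z)⁻¹ := fun i z => inv_nonneg.2 (hw i z)
    have key := (hconst.mul hU (fun _ _ => zero_le_one) (((hf (N + 1)).2.2 v).mul hU hw
      (ih.mul hU hinv ih)))
    refine (key.mono_weight (w' := fun i z => (w i z)⁻¹) zero_le_one
      fun i z hz => ?_).congr hU fun i z hz => ?_
    · have := (hlow i z hz).1
      apply le_of_eq
      field_simp
    · have h1 := ((hf 1).2.1 i).differentiableAt ((hU i).mem_nhds hz)
      have h2 := ((hasFDerivAt_inv' (𝕜 := ℝ) (hne i z hz)).comp z h1.hasFDerivAt).fderiv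
      have h3 := congrArg (fun L : E →L[ℝ] ℂ => L v) h2
      refine Eq.trans ?_ h3.symm
      simp
      ring

theorem of_iteratedFDeriv (hf : ∀ i, ContDiff ℝ (⊤ : ℕ∞) (f i))
    (hb : ∀ n : ℕ, ∃ M : ℝ, ∀ i z, ‖iteratedFDeriv ℝ n (f i) z‖ ≤ M) (N : ℕ) :
    SymbolBound U N (fun _ _ => 1) f := by
  have hb0 : ∃ C, 0 ≤ C ∧ ∀ i, ∀ z ∈ U i, ‖f i z‖ ≤ C * 1 := by
    obtain ⟨M, hM⟩ := hb 0
    refine ⟨max M 0, le_max_right _ _, fun i z _ => ?_⟩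
    have := hM i z
    rw [norm_iteratedFDeriv_zero] at this
    simpa using Or.inl this
  induction N generalizing f with
  | zero => exact hb0
  | succ N ih =>
    refine ⟨hb0, fun i => ((hf i).differentiable (by simp)).differentiableOn, fun v => ?_⟩
    have hd : ∀ i, ContDiff ℝ (⊤ : ℕ∞) (fderiv ℝ (f i)) := fun i =>
      (hf i).fderiv_right (by simp)
    have hbd : ∀ n : ℕ, ∃ M : ℝ, ∀ i z,
        ‖iteratedFDeriv ℝ n (fun z => fderiv ℝ (f i) z v) z‖ ≤ M := by
      intro n
      obtain ⟨M, hM⟩ := hb (n + 1)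
      refine ⟨‖v‖ * M, fun i z => ?_⟩
      refine (norm_iteratedFDeriv_clm_apply_const (hd i).contDiffAt
        (by exact_mod_cast le_top)).trans ?_
      rw [norm_iteratedFDeriv_fderiv]
      exact mul_le_mul_of_nonneg_left (hM i z) (norm_nonneg _)
    refine ih (fun i => (hd i).clm_apply contDiff_const) hbd ?_
    obtain ⟨M, hM⟩ := hbd 0
    refine ⟨max M 0, le_max_right _ _, fun i z _ => ?_⟩
    have := hM i z
    rw [norm_iteratedFDeriv_zero] at this
    simpa using Or.inl this

end SymbolBound

/-- The formal transpose of the first order operator `(u₁ ∂₁ + u₂ ∂₂) / (u₁² + u₂²)`, up to sign. -/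
noncomputable def gradTranspose (u₁ u₂ f : ℝ × ℝ → ℂ) : ℝ × ℝ → ℂ := fun z =>
  fderiv ℝ (fun z => u₁ z * (u₁ z * u₁ z + u₂ z * u₂ z)⁻¹ * f z) z (1, 0) +
  fderiv ℝ (fun z => u₂ z * (u₁ z * u₁ z + u₂ z * u₂ z)⁻¹ * f z) z (0, 1)

theorem contDiff_mul_of_eqOn_compl {E : Type*} [NormedAddCommGroup E] [NormedSpace ℝ E]
    {h f : E → ℂ} {K : Set E} (hK : IsClosed K)
    (hh : ∀ z ∈ K, ContDiffAt ℝ (⊤ : ℕ∞) h z) (hf : ContDiff ℝ (⊤ : ℕ∞) f)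
    (hfK : ∀ z ∉ K, f z = 0) : ContDiff ℝ (⊤ : ℕ∞) (fun z => h z * f z) := by
  rw [contDiff_iff_contDiffAt]
  intro z
  by_cases hz : z ∈ K
  · exact (hh z hz).mul hf.contDiffAt
  · refine (contDiffAt_const (c := (0 : ℂ))).congr_of_eventuallyEq ?_
    filter_upwards [hK.isOpen_compl.mem_nhds hz] with y hy
    rw [hfK y hy, mul_zero]

theorem fderiv_eq_zero_of_eqOn_compl {E : Type*} [NormedAddCommGroup E] [NormedSpace ℝ E]
    {f : E → ℂ} {K : Set E} (hK : IsClosed K) (hfK : ∀ z ∉ K, f z = 0) {z : E} (hz : z ∉ K) :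
    fderiv ℝ f z = 0 := by
  have : f =ᶠ[𝓝 z] fun _ => 0 := by
    filter_upwards [hK.isOpen_compl.mem_nhds hz] with y hy using hfK y hy
  rw [this.fderiv_eq]
  simp

section gradTranspose

variable {u₁ u₂ f : ℝ × ℝ → ℂ} {K : Set (ℝ × ℝ)}

theorem contDiff_div_gradient_mul {u : ℝ × ℝ → ℂ} (hu : ContDiff ℝ (⊤ : ℕ∞) u)
    (hu₁ : ContDiff ℝ (⊤ : ℕ∞) u₁) (hu₂ : ContDiff ℝ (⊤ : ℕ∞) u₂)
    (hK : IsClosed K) (hne : ∀ z ∈ K, u₁ z * u₁ z + u₂ z * u₂ z ≠ 0)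
    (hf : ContDiff ℝ (⊤ : ℕ∞) f) (hfK : ∀ z ∉ K, f z = 0) :
    ContDiff ℝ (⊤ : ℕ∞) (fun z => u z * (u₁ z * u₁ z + u₂ z * u₂ z)⁻¹ * f z) := by
  refine contDiff_mul_of_eqOn_compl hK (fun z hz => ?_) hf hfK
  exact hu.contDiffAt.mul (((hu₁.mul hu₁).add (hu₂.mul hu₂)).contDiffAt.inv (hne z hz))

theorem contDiff_gradTranspose
    (hu₁ : ContDiff ℝ (⊤ : ℕ∞) u₁) (hu₂ : ContDiff ℝ (⊤ : ℕ∞) u₂)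
    (hK : IsClosed K) (hne : ∀ z ∈ K, u₁ z * u₁ z + u₂ z * u₂ z ≠ 0)
    (hf : ContDiff ℝ (⊤ : ℕ∞) f) (hfK : ∀ z ∉ K, f z = 0) :
    ContDiff ℝ (⊤ : ℕ∞) (gradTranspose u₁ u₂ f) := by
  have h₁ := contDiff_div_gradient_mul hu₁ hu₁ hu₂ hK hne hf hfK
  have h₂ := contDiff_div_gradient_mul hu₂ hu₁ hu₂ hK hne hf hfK
  exact ((h₁.fderiv_right (by simp)).clm_apply contDiff_const).add
    ((h₂.fderiv_right (by simp)).clm_apply contDiff_const)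

theorem gradTranspose_eq_zero (hK : IsClosed K) (hfK : ∀ z ∉ K, f z = 0) {z : ℝ × ℝ}
    (hz : z ∉ K) : gradTranspose u₁ u₂ f z = 0 := by
  have h : ∀ u : ℝ × ℝ → ℂ, ∀ z ∉ K, u z * f z = 0 := fun u z hz => by rw [hfK z hz, mul_zero]
  unfold gradTranspose
  rw [fderiv_eq_zero_of_eqOn_compl hK (h _) hz, fderiv_eq_zero_of_eqOn_compl hK (h _) hz]
  simp

/-- One integration by parts against an oscillating exponential. -/
theorem integral_exp_mul_eq_gradTranspose {φ : ℝ × ℝ → ℝ} (hφ : ContDiff ℝ (⊤ : ℕ∞) φ)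
    (h₁ : ∀ z, u₁ z = (fderiv ℝ φ z (1, 0) : ℝ)) (h₂ : ∀ z, u₂ z = (fderiv ℝ φ z (0, 1) : ℝ))
    (hu₁ : ContDiff ℝ (⊤ : ℕ∞) u₁) (hu₂ : ContDiff ℝ (⊤ : ℕ∞) u₂)
    (hK : IsCompact K) (hne : ∀ z ∈ K, u₁ z * u₁ z + u₂ z * u₂ z ≠ 0)
    (hf : ContDiff ℝ (⊤ : ℕ∞) f) (hfK : ∀ z ∉ K, f z = 0) {ε : ℝ} (hε : ε ≠ 0) :
    ∫ z, Complex.exp (-(Complex.I * ((φ z / ε : ℝ) : ℂ))) * f z =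
      (-(Complex.I * ε)) *
        ∫ z, Complex.exp (-(Complex.I * ((φ z / ε : ℝ) : ℂ))) * gradTranspose u₁ u₂ f z := by
  set e : ℝ × ℝ → ℂ := fun z => Complex.exp (-(Complex.I * ((φ z / ε : ℝ) : ℂ))) with he
  have hes : ContDiff ℝ (⊤ : ℕ∞) e := by
    refine ContDiff.cexp (contDiff_const.mul ?_).neg
    exact Complex.ofRealCLM.contDiff.comp (hφ.div_const ε)
  have hde : ∀ z v, fderiv ℝ e z v = -(Complex.I / ε) * (fderiv ℝ φ z v : ℝ) * e z := by
    intro z v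
    have hφz : HasFDerivAt φ (fderiv ℝ φ z) z :=
      ((hφ.differentiable (by simp)) z).hasFDerivAt
    have := (((Complex.ofRealCLM.hasFDerivAt.comp z hφz).const_mul (-(Complex.I / ε))).cexp).fderiv
    have hee : e = fun z => Complex.exp (-(Complex.I / ε) * (Complex.ofRealCLM ∘ φ) z) := by
      funext z
      simp only [he, Function.comp, Complex.ofRealCLM_apply]
      congr 1
      push_cast
      ring
    rw [hee, this]
    simp
    ring
  have hint : ∀ g : ℝ × ℝ → ℂ, Continuous g → (∀ z ∉ K, g z = 0) → Integrable g :=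
    fun g hg hgK => hg.integrable_of_hasCompactSupport (HasCompactSupport.intro hK hgK)
  have parts : ∀ (u : ℝ × ℝ → ℂ) (v : ℝ × ℝ), ContDiff ℝ (⊤ : ℕ∞) u → (∀ z ∉ K, u z = 0) →
      Integrable (fun z => e z * fderiv ℝ u z v) ∧ Integrable (fun z => u z * fderiv ℝ e z v) ∧
      ∫ z, u z * fderiv ℝ e z v = - ∫ z, e z * fderiv ℝ u z v := by
    intro u v hu huK
    have c1 : Continuous fun z => fderiv ℝ u z v :=
      (hu.continuous_fderiv (by simp)).clm_apply continuous_const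
    have c2 : Continuous fun z => fderiv ℝ e z v :=
      (hes.continuous_fderiv (by simp)).clm_apply continuous_const
    have i1 := hint (fun z => fderiv ℝ u z v * e z) (c1.mul hes.continuous) fun z hz => by
      rw [fderiv_eq_zero_of_eqOn_compl hK.isClosed huK hz]; simp
    have i2 := hint (fun z => u z * fderiv ℝ e z v) (hu.continuous.mul c2) fun z hz => by
      rw [huK z hz, zero_mul]
    have i3 := hint (fun z => u z * e z) (hu.continuous.mul hes.continuous) fun z hz => by
      rw [huK z hz, zero_mul]
    refine ⟨by simpa only [mul_comm] using i1, i2, ?_⟩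
    rw [integral_mul_fderiv_eq_neg_fderiv_mul_of_integrable i1 i2 i3
      (fun z _ => hu.differentiable (by simp) z) (fun z _ => hes.differentiable (by simp) z)]
    simp only [mul_comm]
  have hs : ∀ u : ℝ × ℝ → ℂ, ∀ z ∉ K, u z * f z = 0 := fun u z hz => by rw [hfK z hz, mul_zero]
  obtain ⟨a1, b1, c1⟩ := parts _ (1, 0)
    (contDiff_div_gradient_mul hu₁ hu₁ hu₂ hK.isClosed hne hf hfK) (hs _)
  obtain ⟨a2, b2, c2⟩ := parts _ (0, 1)
    (contDiff_div_gradient_mul hu₂ hu₁ hu₂ hK.isClosed hne hf hfK) (hs _)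
  have hsum : ∫ z, e z * gradTranspose u₁ u₂ f z = -∫ z, -(Complex.I / ε) * (e z * f z) := by
    simp only [gradTranspose, mul_add]
    rw [integral_add a1 a2, ← neg_inj, neg_add, ← c1, ← c2, ← integral_add b1 b2, neg_neg]
    congr 1
    funext z
    by_cases hz : z ∈ K
    · have hz' := hne z hz
      rw [hde, hde, ← h₁, ← h₂]
      linear_combination (-(Complex.I / ε) * e z * f z) * mul_inv_cancel₀ hz'
    · simp [hfK z hz]
  rw [hsum, integral_const_mul]
  have hε' : (ε : ℂ) ≠ 0 := by exact_mod_cast hε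
  change ∫ z, e z * f z = _
  generalize ∫ z, e z * f z = J
  field_simp
  rw [Complex.I_sq]
  ring

end gradTranspose

theorem symbolBound_gradTranspose {ι : Type*} {U : ι → Set (ℝ × ℝ)} (hU : ∀ i, IsOpen (U i))
    {u₁ u₂ f : ι → ℝ × ℝ → ℂ} {ρ : ι → ℝ × ℝ → ℝ} (hρ : ∀ i z, 0 ≤ ρ i z)
    (hρU : ∀ i, ∀ z ∈ U i, 0 < ρ i z)
    (hD : ∀ i z, ‖u₁ i z * u₁ i z + u₂ i z * u₂ i z‖ = ρ i z * ρ i z)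
    (h₁ : ∀ N, SymbolBound U N ρ u₁) (h₂ : ∀ N, SymbolBound U N ρ u₂) {k : ℕ}
    (hf : ∀ N, SymbolBound U N (fun i z => (ρ i z)⁻¹ ^ k) f) (N : ℕ) :
    SymbolBound U N (fun i z => (ρ i z)⁻¹ ^ (k + 1))
      (fun i => gradTranspose (u₁ i) (u₂ i) (f i)) := by
  have hsq : ∀ N, SymbolBound U N (fun i z => ρ i z * ρ i z)
      (fun i z => u₁ i z * u₁ i z + u₂ i z * u₂ i z) := fun N =>
    ((h₁ N).mul hU hρ (h₁ N)).add hU ((h₂ N).mul hU hρ (h₂ N))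
  have hinv := SymbolBound.inv hU hsq (fun i z => mul_nonneg (hρ i z) (hρ i z))
    fun i z hz => ⟨mul_pos (hρU i z hz) (hρU i z hz), (hD i z).ge⟩
  have key : ∀ u : ι → ℝ × ℝ → ℂ, (∀ N, SymbolBound U N ρ u) → ∀ N,
      SymbolBound U N (fun i z => (ρ i z)⁻¹ ^ (k + 1))
        (fun i z => u i z * (u₁ i z * u₁ i z + u₂ i z * u₂ i z)⁻¹ * f i z) := by
    intro u hu N
    refine (((hu N).mul hU hρ (hinv N)).mul hU ?_ (hf N)).mono_weight zero_le_one ?_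
    · exact fun i z => mul_nonneg (hρ i z) (inv_nonneg.2 (mul_nonneg (hρ i z) (hρ i z)))
    · intro i z hz
      have := (hρU i z hz).ne'
      apply le_of_eq
      rw [pow_succ]
      field_simp
  exact ((key u₁ h₁ (N + 1)).2.2 (1, 0)).add hU ((key u₂ h₂ (N + 1)).2.2 (0, 1))

theorem SymbolBound.const_add {ι E : Type*} [NormedAddCommGroup E] [NormedSpace ℝ E]
    {U : ι → Set E} {w : ι → E → ℝ} {c : ι → ℂ} {h : E → ℂ} (hh : ContDiff ℝ (⊤ : ℕ∞) h)
    (hb : ∀ n : ℕ, ∃ M : ℝ, ∀ z, ‖iteratedFDeriv ℝ (n + 1) h z‖ ≤ M)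
    (hw : ∀ i z, ‖c i + h z‖ ≤ w i z) {κ : ℝ} (hκ : 0 ≤ κ) (hU : ∀ i, ∀ z ∈ U i, 1 ≤ κ * w i z)
    (N : ℕ) : SymbolBound U N w (fun i z => c i + h z) := by
  have hb0 : ∃ C, 0 ≤ C ∧ ∀ i, ∀ z ∈ U i, ‖c i + h z‖ ≤ C * w i z :=
    ⟨1, zero_le_one, fun i z _ => by simpa using hw i z⟩
  cases N with
  | zero => exact hb0
  | succ N =>
    refine ⟨hb0, fun i => ((contDiff_const.add hh).differentiable (by simp)).differentiableOn,
      fun v => ?_⟩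
    have hd : ContDiff ℝ (⊤ : ℕ∞) (fderiv ℝ h) := hh.fderiv_right (by simp)
    have key : SymbolBound U N (fun _ _ => 1) (fun _ z => fderiv ℝ h z v) := by
      refine SymbolBound.of_iteratedFDeriv (fun _ => hd.clm_apply contDiff_const) (fun n => ?_) N
      obtain ⟨M, hM⟩ := hb n
      refine ⟨‖v‖ * M, fun _ z => ?_⟩
      refine (norm_iteratedFDeriv_clm_apply_const hd.contDiffAt
        (by exact_mod_cast le_top)).trans ?_
      rw [norm_iteratedFDeriv_fderiv]
      exact mul_le_mul_of_nonneg_left (hM z) (norm_nonneg _)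
    simpa only [fderiv_const_add] using key.mono_weight hκ hU

theorem contDiff_neg_ofReal_fderiv_apply {ψ : ℝ × ℝ → ℝ} (hψ : ContDiff ℝ (⊤ : ℕ∞) ψ)
    (v : ℝ × ℝ) : ContDiff ℝ (⊤ : ℕ∞) (fun z => -((fderiv ℝ ψ z v : ℝ) : ℂ)) :=
  (Complex.ofRealCLM.contDiff.comp
    ((hψ.fderiv_right (by simp)).clm_apply contDiff_const)).neg

theorem exists_norm_iteratedFDeriv_neg_ofReal_fderiv_apply_le {ψ : ℝ × ℝ → ℝ}
    (hψ : ContDiff ℝ (⊤ : ℕ∞) ψ)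
    (hb : ∀ n : ℕ, 2 ≤ n → ∃ M : ℝ, ∀ z : ℝ × ℝ, ‖iteratedFDeriv ℝ n ψ z‖ ≤ M)
    (v : ℝ × ℝ) (n : ℕ) :
    ∃ M : ℝ, ∀ z, ‖iteratedFDeriv ℝ (n + 1) (fun z => -((fderiv ℝ ψ z v : ℝ) : ℂ)) z‖ ≤ M := by
  obtain ⟨M, hM⟩ := hb (n + 2) (by omega)
  have hd : ContDiff ℝ (⊤ : ℕ∞) (fderiv ℝ ψ) := hψ.fderiv_right (by simp)
  have hle : ((n + 1 : ℕ) : WithTop ℕ∞) ≤ ((⊤ : ℕ∞) : WithTop ℕ∞) := by exact_mod_cast le_top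
  refine ⟨‖-Complex.ofRealCLM‖ * (‖v‖ * M), fun z => ?_⟩
  refine ((-Complex.ofRealCLM).norm_iteratedFDeriv_comp_left (f := fun z => fderiv ℝ ψ z v)
    (hd.clm_apply contDiff_const).contDiffAt hle).trans ?_
  refine mul_le_mul_of_nonneg_left ?_ (norm_nonneg _)
  refine (norm_iteratedFDeriv_clm_apply_const hd.contDiffAt hle).trans ?_
  rw [norm_iteratedFDeriv_fderiv]
  exact mul_le_mul_of_nonneg_left (hM z) (norm_nonneg _)

/-- The linear map `(s, y) ↦ (εs, s, y)`. -/
noncomputable def slowTimeMap (ε : ℝ) : ℝ × ℝ →L[ℝ] ℝ × ℝ × ℝ :=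
  (ε • ContinuousLinearMap.fst ℝ ℝ ℝ).prod
    ((ContinuousLinearMap.fst ℝ ℝ ℝ).prod (ContinuousLinearMap.snd ℝ ℝ ℝ))

theorem slowTimeMap_apply (ε : ℝ) (z : ℝ × ℝ) : slowTimeMap ε z = (ε * z.1, z.1, z.2) := rfl

theorem norm_slowTimeMap_le {ε : ℝ} (hε : ε ∈ Ioc (0 : ℝ) 1) : ‖slowTimeMap ε‖ ≤ 1 := by
  refine ContinuousLinearMap.opNorm_le_bound _ zero_le_one fun z => ?_
  rw [one_mul, slowTimeMap_apply, Prod.norm_mk, Prod.norm_mk]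
  have h1 : ‖z.1‖ ≤ ‖z‖ := norm_fst_le z
  have h2 : ‖z.2‖ ≤ ‖z‖ := norm_snd_le z
  refine max_le ?_ (max_le h1 h2)
  rw [norm_mul, Real.norm_of_nonneg hε.1.le]
  exact (mul_le_of_le_one_left (norm_nonneg _) hε.2).trans h1

theorem exists_norm_iteratedFDeriv_comp_slowTimeMap_le {a : ℝ × ℝ × ℝ → ℂ}
    (ha : ContDiff ℝ (⊤ : ℕ∞) a)
    (habdd : ∀ n : ℕ, ∃ M : ℝ, ∀ z, ‖iteratedFDeriv ℝ n a z‖ ≤ M) (n : ℕ) :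
    ∃ M : ℝ, ∀ ε ∈ Ioc (0 : ℝ) 1, ∀ z, ‖iteratedFDeriv ℝ n (a ∘ slowTimeMap ε) z‖ ≤ M := by
  obtain ⟨M, hM⟩ := habdd n
  refine ⟨M, fun ε hε z => ?_⟩
  rw [(slowTimeMap ε).iteratedFDeriv_comp_right ha z (by exact_mod_cast le_top)]
  refine (ContinuousMultilinearMap.norm_compContinuousLinearMap_le _ _).trans ?_
  refine (mul_le_of_le_one_right (norm_nonneg _) ?_).trans (hM _)
  exact Finset.prod_le_one (fun _ _ => norm_nonneg _) fun _ _ => norm_slowTimeMap_le hε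

theorem le_of_forall_mem_Ioo_neg_of_mem_Icc {F : ℝ → ℝ} (hF : Continuous F) {r η : ℝ} (hr : 0 < r)
    (h : ∀ y ∈ Ioo (-r) r, η ≤ F y) {y : ℝ} (hy : y ∈ Icc (-r) r) : η ≤ F y := by
  have hcl : closure (Ioo (-r) r) ⊆ {y | η ≤ F y} :=
    closure_minimal h (isClosed_le continuous_const hF)
  rw [closure_Ioo (by linarith)] at hcl
  exact hcl hy

section Phase

variable {p : ℝ → ℝ} {ψ : ℝ × ℝ → ℝ} {t x ξ : ℝ}

theorem contDiff_oscPhase (hψ : ContDiff ℝ (⊤ : ℕ∞) ψ) :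
    ContDiff ℝ (⊤ : ℕ∞) (fun z : ℝ × ℝ => oscPhase p ψ t x z.1 z.2 ξ) :=
  (((contDiff_fst.sub contDiff_const).mul contDiff_const).add
    ((contDiff_const.sub contDiff_snd).mul contDiff_const)).sub hψ

theorem fderiv_oscPhase (hψ : ContDiff ℝ (⊤ : ℕ∞) ψ) (z v : ℝ × ℝ) :
    fderiv ℝ (fun z : ℝ × ℝ => oscPhase p ψ t x z.1 z.2 ξ) z v =
      v.1 * p ξ - v.2 * ξ - fderiv ℝ ψ z v := by
  have h1 : HasFDerivAt (fun z : ℝ × ℝ => oscPhase p ψ t x z.1 z.2 ξ) _ z :=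
    ((((hasFDerivAt_fst (𝕜 := ℝ) (p := z)).sub_const t).mul_const (p ξ)).add
      (((hasFDerivAt_snd (𝕜 := ℝ) (p := z)).const_sub x).mul_const ξ)).sub
      ((hψ.differentiable (by simp)) z).hasFDerivAt
  rw [h1.fderiv]
  simp
  ring

end Phase

theorem exists_norm_integral_exp_oscPhase_le
    {p : ℝ → ℝ} {𝒯 r : ℝ} (hr : 0 < r)
    {ψ : ℝ × ℝ → ℝ} (hψ : ContDiff ℝ (⊤ : ℕ∞) ψ)
    (hψquad : ∀ n : ℕ, 2 ≤ n → ∃ M : ℝ, ∀ z : ℝ × ℝ, ‖iteratedFDeriv ℝ n ψ z‖ ≤ M)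
    {η : ℝ} (hη : 0 < η)
    (hnonres : ∀ s y ξ : ℝ, 0 < s → y ∈ Set.Ioo (-r) r →
      η ≤ |p ξ - fderiv ℝ ψ (s, y) (1, 0)| + |ξ + fderiv ℝ ψ (s, y) (0, 1)|)
    {a : ℝ × ℝ × ℝ → ℂ} (ha : ContDiff ℝ (⊤ : ℕ∞) a)
    (habdd : ∀ n : ℕ, ∃ M : ℝ, ∀ z, ‖iteratedFDeriv ℝ n a z‖ ≤ M)
    (hasupp : ∀ T t x : ℝ, a (T, t, x) ≠ 0 → T ≤ 𝒯 ∧ 1 ≤ t ∧ |x| ≤ r)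
    {n : ℕ} (hn : 2 ≤ n) :
    ∃ C, 0 ≤ C ∧ ∀ ε ∈ Ioc (0 : ℝ) 1, ∀ t x ξ : ℝ,
      ‖∫ z : ℝ × ℝ, Complex.exp (-(Complex.I * ((oscPhase p ψ t x z.1 z.2 ξ / ε : ℝ) : ℂ))) *
          a (ε * z.1, z.1, z.2)‖ ≤
        C * ε ^ n * ∫ z in Icc 1 (𝒯 / ε) ×ˢ Icc (-r) r, (1 + (ξ + fderiv ℝ ψ z (0, 1)) ^ 2)⁻¹ := by
  set h₁ : ℝ × ℝ → ℂ := fun z => -((fderiv ℝ ψ z (1, 0) : ℝ) : ℂ) with hh₁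
  set h₂ : ℝ × ℝ → ℂ := fun z => -((fderiv ℝ ψ z (0, 1) : ℝ) : ℂ) with hh₂
  have ch₁ : ContDiff ℝ (⊤ : ℕ∞) h₁ := contDiff_neg_ofReal_fderiv_apply hψ _
  have ch₂ : ContDiff ℝ (⊤ : ℕ∞) h₂ := contDiff_neg_ofReal_fderiv_apply hψ _
  let u₁ : Ioc (0 : ℝ) 1 × ℝ → ℝ × ℝ → ℂ := fun i z => (p i.2 : ℂ) + h₁ z
  let u₂ : Ioc (0 : ℝ) 1 × ℝ → ℝ × ℝ → ℂ := fun i z => ((-i.2 : ℝ) : ℂ) + h₂ z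
  have cu₁ : ∀ i, ContDiff ℝ (⊤ : ℕ∞) (u₁ i) := fun i => contDiff_const.add ch₁
  have cu₂ : ∀ i, ContDiff ℝ (⊤ : ℕ∞) (u₂ i) := fun i => contDiff_const.add ch₂
  have eu₁ : ∀ i z, u₁ i z = ((p i.2 - fderiv ℝ ψ z (1, 0) : ℝ) : ℂ) := fun i z => by
    simp [u₁, hh₁, sub_eq_add_neg]
  have eu₂ : ∀ i z, u₂ i z = ((-i.2 - fderiv ℝ ψ z (0, 1) : ℝ) : ℂ) := fun i z => by
    simp [u₂, hh₂, sub_eq_add_neg]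
  let D : Ioc (0 : ℝ) 1 × ℝ → ℝ × ℝ → ℝ := fun i z =>
    (p i.2 - fderiv ℝ ψ z (1, 0)) ^ 2 + (-i.2 - fderiv ℝ ψ z (0, 1)) ^ 2
  have hD0 : ∀ i z, 0 ≤ D i z := fun i z => by positivity
  let ρ : Ioc (0 : ℝ) 1 × ℝ → ℝ × ℝ → ℝ := fun i z => √(D i z)
  have hρ0 : ∀ i z, 0 ≤ ρ i z := fun i z => Real.sqrt_nonneg _
  have hρsq : ∀ i z, ρ i z * ρ i z = D i z := fun i z => Real.mul_self_sqrt (hD0 i z)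
  have hDu : ∀ i z, u₁ i z * u₁ i z + u₂ i z * u₂ i z = ((D i z : ℝ) : ℂ) := fun i z => by
    rw [eu₁, eu₂]
    push_cast [D]
    ring
  have hnorm : ∀ i z, ‖u₁ i z * u₁ i z + u₂ i z * u₂ i z‖ = ρ i z * ρ i z := fun i z => by
    rw [hDu, Complex.norm_real, Real.norm_of_nonneg (hD0 i z), hρsq]
  have cd : ∀ v : ℝ × ℝ, Continuous fun z => fderiv ℝ ψ z v := fun v =>
    (hψ.continuous_fderiv (by simp)).clm_apply continuous_const
  have cρ : ∀ i, Continuous (ρ i) := fun i =>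
    (((continuous_const.sub (cd _)).pow 2).add ((continuous_const.sub (cd _)).pow 2)).sqrt
  let U : Ioc (0 : ℝ) 1 × ℝ → Set (ℝ × ℝ) := fun i => {z | η / 2 < ρ i z}
  have hU : ∀ i, IsOpen (U i) := fun i => isOpen_lt continuous_const (cρ i)
  have hρU : ∀ i, ∀ z ∈ U i, 0 < ρ i z := fun i z hz => (half_pos hη).trans hz
  let K : ℝ → Set (ℝ × ℝ) := fun ε => Icc 1 (𝒯 / ε) ×ˢ Icc (-r) r
  have hK : ∀ ε, IsCompact (K ε) := fun ε => isCompact_Icc.prod isCompact_Icc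
  have hKU : ∀ i : Ioc (0 : ℝ) 1 × ℝ, K i.1 ⊆ U i := by
    rintro i ⟨s, y⟩ ⟨hs, hy⟩
    have hs0 : (0 : ℝ) < s := zero_lt_one.trans_le hs.1
    have hle : η ≤ |p i.2 - fderiv ℝ ψ (s, y) (1, 0)| + |i.2 + fderiv ℝ ψ (s, y) (0, 1)| := by
      refine le_of_forall_mem_Ioo_neg_of_mem_Icc (F := fun y => |p i.2 - fderiv ℝ ψ (s, y) (1, 0)| +
        |i.2 + fderiv ℝ ψ (s, y) (0, 1)|) ?_ hr (fun y hy => hnonres s y i.2 hs0 hy) hy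
      have cy : Continuous fun y : ℝ => (s, y) := by fun_prop
      exact (continuous_const.sub ((cd _).comp cy)).abs.add
        (continuous_const.add ((cd _).comp cy)).abs
    refine Real.lt_sqrt_of_sq_lt ?_
    simp only [D]
    set A := p i.2 - fderiv ℝ ψ (s, y) (1, 0)
    have hB : -i.2 - fderiv ℝ ψ (s, y) (0, 1) = -(i.2 + fderiv ℝ ψ (s, y) (0, 1)) := by ring
    rw [hB, neg_sq]
    set B := i.2 + fderiv ℝ ψ (s, y) (0, 1)
    rw [← sq_abs A, ← sq_abs B]
    nlinarith [sq_nonneg (|A| - |B|), abs_nonneg A, abs_nonneg B]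
  have hu_le₁ : ∀ i z, ‖u₁ i z‖ ≤ ρ i z := fun i z => by
    rw [eu₁, Complex.norm_real, Real.norm_eq_abs]
    exact Real.abs_le_sqrt (le_add_of_nonneg_right (sq_nonneg _))
  have hu_le₂ : ∀ i z, ‖u₂ i z‖ ≤ ρ i z := fun i z => by
    rw [eu₂, Complex.norm_real, Real.norm_eq_abs]
    exact Real.abs_le_sqrt (le_add_of_nonneg_left (sq_nonneg _))
  have hone : ∀ i, ∀ z ∈ U i, 1 ≤ 2 / η * ρ i z := fun i z hz => by
    have : η / 2 < ρ i z := hz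
    rw [div_mul_eq_mul_div, le_div_iff₀ hη]
    linarith
  have su₁ : ∀ N, SymbolBound U N ρ u₁ := SymbolBound.const_add ch₁
    (exists_norm_iteratedFDeriv_neg_ofReal_fderiv_apply_le hψ hψquad _) hu_le₁ (by positivity) hone
  have su₂ : ∀ N, SymbolBound U N ρ u₂ := SymbolBound.const_add ch₂
    (exists_norm_iteratedFDeriv_neg_ofReal_fderiv_apply_le hψ hψquad _) hu_le₂ (by positivity) hone
  have hne : ∀ i : Ioc (0 : ℝ) 1 × ℝ, ∀ z ∈ K i.1, u₁ i z * u₁ i z + u₂ i z * u₂ i z ≠ 0 :=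
    fun i z hz => norm_pos_iff.1 <| by
      rw [hnorm]
      exact mul_pos (hρU i z (hKU i hz)) (hρU i z (hKU i hz))
  let f : ℕ → Ioc (0 : ℝ) 1 × ℝ → ℝ × ℝ → ℂ := fun k i =>
    (gradTranspose (u₁ i) (u₂ i))^[k] (a ∘ slowTimeMap i.1)
  have fsucc : ∀ k i, f (k + 1) i = gradTranspose (u₁ i) (u₂ i) (f k i) := fun k i =>
    Function.iterate_succ_apply' _ _ _
  have hfK : ∀ k, ∀ i : Ioc (0 : ℝ) 1 × ℝ, ∀ z ∉ K i.1, f k i z = 0 := by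
    intro k i
    induction k with
    | zero =>
      intro z hz
      by_contra h0
      obtain ⟨h1, h2, h3⟩ := hasupp _ _ _ h0
      refine hz ⟨⟨h2, ?_⟩, abs_le.1 h3⟩
      rw [le_div_iff₀ i.1.2.1, mul_comm]
      exact h1
    | succ k ih =>
      intro z hz
      rw [fsucc]
      exact gradTranspose_eq_zero (hK _).isClosed ih hz
  have cf : ∀ k i, ContDiff ℝ (⊤ : ℕ∞) (f k i) := by
    intro k i
    induction k with
    | zero => exact ha.comp (slowTimeMap i.1).contDiff
    | succ k ih =>
      rw [fsucc]
      exact contDiff_gradTranspose (cu₁ i) (cu₂ i) (hK _).isClosed (hne i) ih (hfK k i)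
  have sf : ∀ k N, SymbolBound U N (fun i z => (ρ i z)⁻¹ ^ k) (f k) := by
    intro k
    induction k with
    | zero =>
      simp only [pow_zero]
      refine SymbolBound.of_iteratedFDeriv (cf 0) fun m => ?_
      obtain ⟨M, hM⟩ := exists_norm_iteratedFDeriv_comp_slowTimeMap_le ha habdd m
      exact ⟨M, fun i z => hM i.1 i.1.2 z⟩
    | succ k ih =>
      have : f (k + 1) = fun i => gradTranspose (u₁ i) (u₂ i) (f k i) := funext (fsucc k)
      rw [this]
      exact symbolBound_gradTranspose hU hρ0 hρU hnorm su₁ su₂ ih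
  obtain ⟨C, hC, hfC⟩ := (sf n 0).bound
  refine ⟨C * ((2 / η) ^ (n - 2) * (1 + 4 / η ^ 2)), by positivity, fun ε hε t x ξ => ?_⟩
  let i : Ioc (0 : ℝ) 1 × ℝ := (⟨ε, hε⟩, ξ)
  let e : ℝ × ℝ → ℂ := fun z =>
    Complex.exp (-(Complex.I * ((oscPhase p ψ t x z.1 z.2 ξ / ε : ℝ) : ℂ)))
  have parts : ∀ k, ∫ z, e z * f 0 i z = (-(Complex.I * ε)) ^ k * ∫ z, e z * f k i z := by
    intro k
    induction k with
    | zero => simp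
    | succ k ih =>
      rw [ih, pow_succ, mul_assoc, fsucc]
      congr 1
      refine integral_exp_mul_eq_gradTranspose (contDiff_oscPhase hψ) (fun z => ?_) (fun z => ?_)
        (cu₁ i) (cu₂ i) (hK ε) (hne i) (cf k i) (hfK k i) hε.1.ne'
      · rw [eu₁, fderiv_oscPhase hψ]
        simp [i]
      · rw [eu₂, fderiv_oscPhase hψ]
        simp [i]
  have hnorm_e : ∀ z, ‖e z‖ = 1 := fun z => by
    simp only [e]
    rw [mul_comm, ← neg_mul, ← Complex.ofReal_neg, Complex.norm_exp_ofReal_mul_I]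
  have hpt : ∀ z ∈ K ε, ‖e z * f n i z‖ ≤
      C * ((2 / η) ^ (n - 2) * (1 + 4 / η ^ 2)) * (1 + (ξ + fderiv ℝ ψ z (0, 1)) ^ 2)⁻¹ := by
    intro z hz
    have hzU := hKU i hz
    have hpos := hρU i z hzU
    have hlt : η / 2 < ρ i z := hzU
    rw [norm_mul, hnorm_e, one_mul]
    refine (hfC i z hzU).trans ?_
    rw [mul_assoc]
    refine mul_le_mul_of_nonneg_left ?_ hC
    have hsplit : (ρ i z)⁻¹ ^ n = (ρ i z)⁻¹ ^ (n - 2) * (ρ i z * ρ i z)⁻¹ := by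
      rw [mul_inv, ← pow_two, ← pow_add, Nat.sub_add_cancel hn]
    rw [hsplit, mul_assoc]
    refine mul_le_mul ?_ ?_ (inv_nonneg.2 (mul_self_nonneg _)) (by positivity)
    · refine pow_le_pow_left₀ (inv_nonneg.2 hpos.le) ?_ _
      rw [← inv_div]
      exact inv_anti₀ (by positivity) hlt.le
    · have h2 : (0 : ℝ) < 1 + (ξ + fderiv ℝ ψ z (0, 1)) ^ 2 := by positivity
      rw [← div_eq_mul_inv, le_div_iff₀ h2, inv_mul_le_iff₀ (mul_pos hpos hpos)]
      have h3 : (ξ + fderiv ℝ ψ z (0, 1)) ^ 2 ≤ ρ i z * ρ i z := by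
        rw [hρsq]
        simp only [D, i]
        nlinarith [sq_nonneg (p ξ - fderiv ℝ ψ z (1, 0))]
      have h4 : 1 ≤ ρ i z * ρ i z * (4 / η ^ 2) := by
        rw [mul_div_assoc', le_div_iff₀ (by positivity)]
        nlinarith
      linarith
  have hbound : ‖∫ z, e z * f n i z‖ ≤ ∫ z in K ε,
      C * ((2 / η) ^ (n - 2) * (1 + 4 / η ^ 2)) * (1 + (ξ + fderiv ℝ ψ z (0, 1)) ^ 2)⁻¹ := by
    rw [← setIntegral_eq_integral_of_forall_compl_eq_zero (s := K ε)
      (fun z hz => by rw [hfK n i z hz, mul_zero])]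
    refine norm_integral_le_of_norm_le ?_
      ((ae_restrict_mem (hK ε).measurableSet).mono fun z hz => hpt z hz)
    refine ContinuousOn.integrableOn_compact (hK ε) (Continuous.continuousOn ?_)
    refine continuous_const.mul (Continuous.inv₀ ?_ fun z => by positivity)
    exact continuous_const.add ((continuous_const.add (cd _)).pow 2)
  change ‖∫ z, e z * f 0 i z‖ ≤ _
  rw [parts n, norm_mul, norm_pow, norm_neg, norm_mul, Complex.norm_I, one_mul,
    Complex.norm_real, Real.norm_of_nonneg hε.1.le]
  refine (mul_le_mul_of_nonneg_left hbound (by have := hε.1; positivity)).trans_eq ?_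
  rw [integral_const_mul]
  ring

section Decay

variable {E : Type*} [MeasurableSpace E] [TopologicalSpace E] [OpensMeasurableSpace E]
  [SecondCountableTopology E] {ν : Measure E} [IsFiniteMeasure ν] {h : E → ℝ}

theorem integrable_prod_inv_one_add_sq (hh : Continuous h) :
    Integrable (fun q : ℝ × E => (1 + (q.1 + h q.2) ^ 2)⁻¹) (volume.prod ν) := by
  have hc : Continuous fun q : ℝ × E => (1 + (q.1 + h q.2) ^ 2)⁻¹ :=
    (continuous_const.add ((continuous_fst.add (hh.comp continuous_snd)).pow 2)).inv₀
      fun q => (by positivity : (1 + (q.1 + h q.2) ^ 2) ≠ 0)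
  rw [integrable_prod_iff' hc.measurable.aestronglyMeasurable]
  refine ⟨Eventually.of_forall fun z => integrable_inv_one_add_sq.comp_add_right (h z), ?_⟩
  have : ∀ z, ∫ ξ : ℝ, ‖(1 + (ξ + h z) ^ 2)⁻¹‖ = π := fun z => by
    rw [integral_add_right_eq_self (fun ξ : ℝ => ‖(1 + ξ ^ 2)⁻¹‖) (h z),
      ← integral_univ_inv_one_add_sq]
    congr 1
    funext ξ
    rw [Real.norm_of_nonneg (by positivity)]
  simp only [this]
  exact integrable_const _

theorem integral_integral_inv_one_add_sq (hh : Continuous h) :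
    ∫ ξ : ℝ, ∫ z, (1 + (ξ + h z) ^ 2)⁻¹ ∂ν = π * ν.real univ := by
  rw [integral_integral_swap (integrable_prod_inv_one_add_sq hh)]
  have : ∀ z, ∫ ξ : ℝ, (1 + (ξ + h z) ^ 2)⁻¹ = π := fun z => by
    rw [integral_add_right_eq_self (fun ξ : ℝ => (1 + ξ ^ 2)⁻¹) (h z),
      integral_univ_inv_one_add_sq]
  simp only [this, integral_const, smul_eq_mul]
  ring

end Decay

theorem oscInner_eq {p : ℝ → ℝ} {ψ : ℝ × ℝ → ℝ} (hψ : ContDiff ℝ (⊤ : ℕ∞) ψ) {ζ : ℝ → ℝ}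
    {a : ℝ × ℝ × ℝ → ℂ} (ha : ContDiff ℝ (⊤ : ℕ∞) a) {𝒯 r : ℝ}
    (hasupp : ∀ T t x : ℝ, a (T, t, x) ≠ 0 → T ≤ 𝒯 ∧ 1 ≤ t ∧ |x| ≤ r)
    {ε t : ℝ} (hε : 0 < ε) (ht : 𝒯 / ε ≤ t) (x ξ : ℝ) :
    oscInner p ψ ζ a ε t x ξ = ζ ξ * ∫ z : ℝ × ℝ,
      Complex.exp (-(Complex.I * ((oscPhase p ψ t x z.1 z.2 ξ / ε : ℝ) : ℂ))) *
        a (ε * z.1, z.1, z.2) := by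
  have hs : ∀ s y : ℝ, a (ε * s, s, y) ≠ 0 → s ∈ Icc 1 (𝒯 / ε) ∧ y ∈ Icc (-r) r := by
    intro s y h
    obtain ⟨h1, h2, h3⟩ := hasupp _ _ _ h
    exact ⟨⟨h2, by rw [le_div_iff₀ hε, mul_comm]; exact h1⟩, abs_le.1 h3⟩
  unfold oscInner
  rw [setIntegral_eq_integral_of_forall_compl_eq_zero]
  · rw [← integral_const_mul, Measure.volume_eq_prod, integral_prod]
    · congr 1
      funext s
      congr 1
      funext y
      ring
    · rw [← Measure.volume_eq_prod]
      refine Continuous.integrable_of_hasCompactSupport ?_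
        (HasCompactSupport.intro ((isCompact_Icc (a := 1) (b := 𝒯 / ε)).prod
          (isCompact_Icc (a := -r) (b := r))) fun z hz => ?_)
      · have hφ := (contDiff_oscPhase (p := p) (t := t) (x := x) (ξ := ξ) hψ).continuous
        have := ha.continuous
        fun_prop
      · have : a (ε * z.1, z.1, z.2) = 0 := by
          by_contra h0
          exact hz (hs _ _ h0)
        rw [this, mul_zero, mul_zero]
  · intro s hs'
    have : ∀ y, a (ε * s, s, y) = 0 := by
      intro y
      by_contra h0
      have := (hs s y h0).1
      exact hs' ⟨zero_le_one.trans this.1, this.2.trans ht⟩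
    simp [this]

theorem aestronglyMeasurable_oscInner {p : ℝ → ℝ} (hp : Continuous p)
    {ψ : ℝ × ℝ → ℝ} (hψ : Continuous ψ) {ζ : ℝ → ℝ} (hζ : Continuous ζ)
    {a : ℝ × ℝ × ℝ → ℂ} (ha : Continuous a) (ε t x : ℝ) :
    AEStronglyMeasurable (fun ξ => oscInner p ψ ζ a ε t x ξ) := by
  unfold oscInner oscPhase
  have hc : Continuous fun q : (ℝ × ℝ) × ℝ =>
      Complex.exp (-(Complex.I * ((((q.1.2 - t) * p q.1.1 + (x - q.2) * q.1.1 - ψ (q.1.2, q.2)) / ε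
        : ℝ) : ℂ))) * ((ζ q.1.1 : ℝ) : ℂ) * a (ε * q.1.2, q.1.2, q.2) := by
    fun_prop
  have h1 := hc.stronglyMeasurable.integral_prod_right' (ν := (volume : Measure ℝ))
  exact (h1.integral_prod_right' (ν := volume.restrict (Icc (0 : ℝ) t))).aestronglyMeasurable

theorem exists_abs_le_of_asymptotic_one {ζ : ℝ → ℝ} (hζ : Continuous ζ)
    (hζ1 : ∃ C R : ℝ, ∀ ξ : ℝ, R ≤ |ξ| → |ζ ξ - 1| ≤ C / |ξ|) :
    ∃ Z, 0 ≤ Z ∧ ∀ ξ, |ζ ξ| ≤ Z := by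
  obtain ⟨C, R, h⟩ := hζ1
  obtain ⟨M, hM⟩ := (isCompact_Icc (a := -max R 1) (b := max R 1)).exists_bound_of_continuousOn
    hζ.continuousOn
  have hM0 : 0 ≤ M := (norm_nonneg _).trans
    (hM 0 (abs_le.1 (by rw [abs_zero]; positivity)))
  refine ⟨max M (1 + |C|), le_max_of_le_left hM0, fun ξ => ?_⟩
  by_cases hξ : |ξ| ≤ max R 1
  · exact le_max_of_le_left (hM ξ (abs_le.1 hξ))
  · push Not at hξ
    have h1 : 1 ≤ |ξ| := (le_max_right _ _).trans hξ.le
    have h2 := h ξ ((le_max_left _ _).trans hξ.le)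
    have h3 : C / |ξ| ≤ |C| := (div_le_div_of_nonneg_right (le_abs_self C) (abs_nonneg _)).trans
      (div_le_self (abs_nonneg C) h1)
    refine le_max_of_le_right ?_
    have h4 := abs_add_le (ζ ξ - 1) 1
    rw [sub_add_cancel, abs_one] at h4
    linarith

theorem quadConst_nonneg (ψ : ℝ × ℝ → ℝ) (n : ℕ) : 0 ≤ quadConst ψ n :=
  Real.iSup_nonneg fun _ => Real.iSup_nonneg fun _ => norm_nonneg _

theorem norm_le_Wnorm {a : ℝ × ℝ × ℝ → ℂ}
    (habdd : ∀ n : ℕ, ∃ M : ℝ, ∀ z, ‖iteratedFDeriv ℝ n a z‖ ≤ M) (n : ℕ) (z : ℝ × ℝ × ℝ) :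
    ‖a z‖ ≤ Wnorm a n := by
  obtain ⟨M, hM⟩ := habdd 0
  have h1 : ‖a z‖ ≤ ⨆ z, ‖iteratedFDeriv ℝ 0 a z‖ := by
    rw [← norm_iteratedFDeriv_zero (𝕜 := ℝ)]
    exact le_ciSup (f := fun z => ‖iteratedFDeriv ℝ 0 a z‖) ⟨M, by rintro _ ⟨z, rfl⟩; exact hM z⟩ z
  exact h1.trans (le_ciSup (f := fun k : Fin (n + 1) => ⨆ z, ‖iteratedFDeriv ℝ (k : ℕ) a z‖)
    (Set.finite_range _).bddAbove 0)

/-- Vanishing of non-resonant oscillatory integrals: for `t ∈ [𝒯/ε, 2𝒯/ε]`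
the inner integral is integrable in `ξ`, so that `𝓘(ε,t,x)` is well defined,
and for every `n ≥ 2` there is a constant `C_n > 0`, independent of
`ε ∈ (0,1]`, `t ∈ [𝒯/ε, 2𝒯/ε]` and `x ∈ ℝ`, with
`|𝓘(ε,t,x)| ≤ C_n r 𝒯 ε^{n-1/2} η^{1-4n} (1+B_n)^n ‖a‖_{W^{n,∞}}`. -/
theorem nonresonant_oscillatory_integral_vanishes
    (q : ℕ) (hq : 2 ≤ q)
    (p : ℝ → ℝ) (ξc ℓ : ℝ)
    (hp : ContDiff ℝ (⊤ : ℕ∞) p)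
    (hpeven : ∀ ξ, p (-ξ) = p ξ)
    (hξc : 0 ≤ ξc)
    (hpzero : ∀ ξ ∈ Set.Icc (-ξc) ξc, p ξ = 0)
    (hp' : ∀ ξ, ξc < ξ → 0 < deriv p ξ)
    (hp1 : Tendsto p atTop (𝓝 1))
    (hp'0 : Tendsto (deriv p) atTop (𝓝 0))
    (hℓ : ℓ < 0)
    (hp'' : Tendsto (fun ξ : ℝ => ξ ^ (q + 2) * deriv (deriv p) ξ) atTop (𝓝 ℓ))
    (𝒯 r : ℝ) (h𝒯 : 0 < 𝒯) (hr : 0 < r)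
    (ψ : ℝ × ℝ → ℝ) (hψ : ContDiff ℝ (⊤ : ℕ∞) ψ)
    (hψquad : ∀ n : ℕ, 2 ≤ n → ∃ M : ℝ, ∀ z : ℝ × ℝ, ‖iteratedFDeriv ℝ n ψ z‖ ≤ M)
    (η : ℝ) (hη : 0 < η)
    (hnonres : ∀ s y ξ : ℝ, 0 < s → y ∈ Set.Ioo (-r) r →
      η ≤ |p ξ - fderiv ℝ ψ (s, y) (1, 0)| + |ξ + fderiv ℝ ψ (s, y) (0, 1)|)
    (ζ : ℝ → ℝ) (hζ : ContDiff ℝ (⊤ : ℕ∞) ζ)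
    (hζ1 : ∃ C R : ℝ, ∀ ξ : ℝ, R ≤ |ξ| → |ζ ξ - 1| ≤ C / |ξ|)
    (a : ℝ × ℝ × ℝ → ℂ) (ha : ContDiff ℝ (⊤ : ℕ∞) a)
    (habdd : ∀ n : ℕ, ∃ M : ℝ, ∀ z, ‖iteratedFDeriv ℝ n a z‖ ≤ M)
    (hasupp : ∀ T t x : ℝ, a (T, t, x) ≠ 0 → T ≤ 𝒯 ∧ 1 ≤ t ∧ |x| ≤ r) :
    (∀ ε ∈ Set.Ioc (0:ℝ) 1, ∀ t ∈ Set.Icc (𝒯 / ε) (2 * 𝒯 / ε), ∀ x : ℝ,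
      Integrable (fun ξ : ℝ => oscInner p ψ ζ a ε t x ξ)) ∧
    (∀ n : ℕ, 2 ≤ n → ∃ C : ℝ, 0 < C ∧
      ∀ ε ∈ Set.Ioc (0:ℝ) 1, ∀ t ∈ Set.Icc (𝒯 / ε) (2 * 𝒯 / ε), ∀ x : ℝ,
        ‖oscIntegral p ψ ζ a ε t x‖ ≤
          C * r * 𝒯 * ε ^ ((n : ℝ) - 1/2) * η ^ (1 - 4 * (n : ℝ)) *
            (1 + quadConst ψ n) ^ n * Wnorm a n) := by
  obtain ⟨Z, hZ0, hZ⟩ := exists_abs_le_of_asymptotic_one hζ.continuous hζ1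
  have cd : Continuous fun z => fderiv ℝ ψ z (0, 1) :=
    (hψ.continuous_fderiv (by simp)).clm_apply continuous_const
  let K : ℝ → Set (ℝ × ℝ) := fun ε => Icc 1 (𝒯 / ε) ×ˢ Icc (-r) r
  let M : ℝ → ℝ → ℝ := fun ε ξ => ∫ z in K ε, (1 + (ξ + fderiv ℝ ψ z (0, 1)) ^ 2)⁻¹
  have hK : ∀ ε, IsCompact (K ε) := fun ε => isCompact_Icc.prod isCompact_Icc
  have hfin : ∀ ε, IsFiniteMeasure ((volume : Measure (ℝ × ℝ)).restrict (K ε)) := fun ε =>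
    isFiniteMeasure_restrict.2 (hK ε).measure_lt_top.ne
  have hMint : ∀ ε, Integrable (M ε) := fun ε =>
    (integrable_prod_inv_one_add_sq (ν := volume.restrict (K ε)) cd).integral_prod_left
  have hMle : ∀ ε ∈ Ioc (0 : ℝ) 1, ∫ ξ, M ε ξ ≤ π * (𝒯 / ε * (2 * r)) := by
    intro ε hε
    have h1 : 0 ≤ 𝒯 / ε := by have := hε.1; positivity
    refine (integral_integral_inv_one_add_sq (ν := volume.restrict (K ε)) cd).trans_le ?_
    refine mul_le_mul_of_nonneg_left ?_ pi_pos.le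
    rw [measureReal_restrict_apply_univ, Measure.volume_eq_prod, measureReal_prod_prod,
      Real.volume_real_Icc, Real.volume_real_Icc]
    refine mul_le_mul (max_le (by linarith) h1) (max_le (by linarith) (by positivity))
      (le_max_right _ _) h1
  have hinner : ∀ n : ℕ, 2 ≤ n → ∃ C, 0 ≤ C ∧ ∀ ε ∈ Ioc (0 : ℝ) 1,
      ∀ t ∈ Icc (𝒯 / ε) (2 * 𝒯 / ε), ∀ x ξ : ℝ,
        ‖oscInner p ψ ζ a ε t x ξ‖ ≤ C * ε ^ n * M ε ξ := by
    intro n hn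
    obtain ⟨C, hC, h⟩ :=
      exists_norm_integral_exp_oscPhase_le hr hψ hψquad hη hnonres ha habdd hasupp hn
    refine ⟨Z * C, by positivity, fun ε hε t ht x ξ => ?_⟩
    rw [oscInner_eq hψ ha hasupp hε.1 ht.1, norm_mul, Complex.norm_real, mul_assoc Z, mul_assoc Z]
    exact mul_le_mul (hZ ξ) (h ε hε t x ξ) (norm_nonneg _) hZ0
  refine ⟨fun ε hε t ht x => ?_, fun n hn => ?_⟩
  · obtain ⟨C, _, h⟩ := hinner 2 le_rfl
    exact ((hMint ε).const_mul (C * ε ^ 2)).mono' (aestronglyMeasurable_oscInner hp.continuous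
      hψ.continuous hζ.continuous ha.continuous ε t x) (Eventually.of_forall (h ε hε t ht x))
  · have hB := quadConst_nonneg ψ n
    by_cases hW : Wnorm a n ≤ 0
    · have ha0 : ∀ z, a z = 0 := fun z =>
        norm_le_zero_iff.1 ((norm_le_Wnorm habdd n z).trans hW)
      have hW0 : Wnorm a n = 0 := hW.antisymm ((norm_nonneg _).trans (norm_le_Wnorm habdd n 0))
      refine ⟨1, one_pos, fun ε _ t _ x => ?_⟩
      simp [oscIntegral, oscInner, ha0, hW0]
    · push Not at hW
      obtain ⟨C, hC, h⟩ := hinner n hn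
      have hP : 0 < η ^ (1 - 4 * (n : ℝ)) * (1 + quadConst ψ n) ^ n * Wnorm a n := by positivity
      refine ⟨(C + 1) / (η ^ (1 - 4 * (n : ℝ)) * (1 + quadConst ψ n) ^ n * Wnorm a n),
        by positivity, fun ε hε t ht x => ?_⟩
      have hε0 := hε.1
      have hint : ‖∫ ξ, oscInner p ψ ζ a ε t x ξ‖ ≤ C * ε ^ n * (π * (𝒯 / ε * (2 * r))) := by
        refine (norm_integral_le_of_norm_le ((hMint ε).const_mul (C * ε ^ n))
          (Eventually.of_forall (h ε hε t ht x))).trans ?_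
        rw [integral_const_mul]
        exact mul_le_mul_of_nonneg_left (hMle ε hε) (by positivity)
      have hpow : ε ^ ((n : ℝ) - 1 / 2) = √ε * ε ^ n / ε := by
        rw [Real.sqrt_eq_rpow, ← Real.rpow_natCast, ← Real.rpow_add hε0]
        nth_rewrite 3 [← Real.rpow_one ε]
        rw [← Real.rpow_sub hε0]
        congr 1
        ring
      have hrhs : (C + 1) / (η ^ (1 - 4 * (n : ℝ)) * (1 + quadConst ψ n) ^ n * Wnorm a n) *
          r * 𝒯 * ε ^ ((n : ℝ) - 1 / 2) * η ^ (1 - 4 * (n : ℝ)) *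
            (1 + quadConst ψ n) ^ n * Wnorm a n = (C + 1) * r * 𝒯 * (√ε * ε ^ n / ε) := by
        rw [← hpow]
        field_simp
      rw [hrhs, oscIntegral, norm_mul, Complex.norm_real, Real.norm_of_nonneg (by positivity)]
      refine (mul_le_mul_of_nonneg_left hint (by positivity)).trans ?_
      have : √ε / (2 * π) * (C * ε ^ n * (π * (𝒯 / ε * (2 * r)))) =
          C * (r * 𝒯 * (√ε * ε ^ n / ε)) := by
        field_simp
      rw [this, mul_assoc (C + 1), mul_assoc (C + 1)]
      exact mul_le_mul_of_nonneg_right (by linarith) (by positivity)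
end

section
/- Pointwise behaviour of the model kernel: define K̃_τ(y) := ∫_ℝ e^{−iyξ} (e^{−iτ/ξ²} − 1) dξ for τ > 0 (an absolutely convergent Lebesgue integral). Then (i) for all τ > 0, K̃_τ(0) = τ^{1/2} · K̃_1(0), with K̃_1(0) = 2∫₀^{+∞}(e^{−i/u²} − 1) du ≠ 0; and (ii) for every fixed y ≠ 0 there exists C > 0 such that |K̃_τ(y)| ≤ C τ^{1/6} for all τ ≥ 1. -/
open Real MeasureTheory Set

/-- The model kernel `K̃_τ(y) = ∫ e^{-iyξ} (e^{-iτ/ξ²} - 1) dξ`. -/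
noncomputable def modelKernel (τ y : ℝ) : ℂ :=
  ∫ ξ : ℝ, Complex.exp (-(Complex.I * (y:ℂ) * (ξ:ℂ))) *
    (Complex.exp (-(Complex.I * (τ:ℂ) / ((ξ:ℂ)) ^ 2)) - 1)

/-- First derivative test of van der Corput for a concave phase: if `φ'' ≤ 0` and
`|φ'| ≥ l` on `[a, b]`, then the oscillatory integral of `e^{iφ}` is at most `4 / l`. -/
theorem norm_integral_exp_phase_le {φ φ' φ'' : ℝ → ℝ} {a b l : ℝ} (hab : a ≤ b) (hl : 0 < l)
    (hφ : ∀ x ∈ Icc a b, HasDerivAt φ (φ' x) x)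
    (hφ' : ∀ x ∈ Icc a b, HasDerivAt φ' (φ'' x) x)
    (hcont : ContinuousOn φ'' (Icc a b))
    (hconc : ∀ x ∈ Icc a b, φ'' x ≤ 0)
    (hlow : ∀ x ∈ Icc a b, l ≤ |φ' x|) :
    ‖∫ x in a..b, Complex.exp (Complex.I * (φ x : ℂ))‖ ≤ 4 / l := by
  have hne : ∀ x ∈ Icc a b, φ' x ≠ 0 := fun x hx h => by
    have := hlow x hx
    rw [h, abs_zero] at this
    linarith
  have hφ'c : ContinuousOn φ' (Icc a b) := fun x hx => (hφ' x hx).continuousAt.continuousWithinAt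
  have hg : ∀ x ∈ Icc a b, HasDerivAt (fun t => (φ' t)⁻¹) (-φ'' x / φ' x ^ 2) x :=
    fun x hx => (hφ' x hx).fun_inv (hne x hx)
  have hgc : ContinuousOn (fun x => -φ'' x / φ' x ^ 2) (Icc a b) :=
    hcont.neg.div (hφ'c.pow 2) fun x hx => pow_ne_zero 2 (hne x hx)
  have hginv : ∀ x ∈ Icc a b, |(φ' x)⁻¹| ≤ 1 / l := fun x hx => by
    rw [abs_inv, ← one_div]
    exact one_div_le_one_div_of_le hl (hlow x hx)
  have hv : ∀ x ∈ Icc a b, HasDerivAt (fun t => Complex.exp (Complex.I * (φ t : ℂ)))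
      (Complex.exp (Complex.I * (φ x : ℂ)) * (Complex.I * (φ' x : ℂ))) x :=
    fun x hx => ((hφ x hx).ofReal_comp.const_mul Complex.I).cexp
  have hexpc : ContinuousOn (fun x => Complex.exp (Complex.I * (φ x : ℂ))) (Icc a b) :=
    fun x hx => (hv x hx).continuousAt.continuousWithinAt
  have hnorm : ∀ x : ℝ, ‖Complex.exp (Complex.I * (φ x : ℂ))‖ = 1 := fun x => by
    rw [mul_comm]
    exact Complex.norm_exp_ofReal_mul_I _
  have parts := intervalIntegral.integral_mul_deriv_eq_deriv_mul (a := a) (b := b)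
    (u := fun x => (((φ' x)⁻¹ : ℝ) : ℂ)) (u' := fun x => ((-φ'' x / φ' x ^ 2 : ℝ) : ℂ))
    (v := fun x => Complex.exp (Complex.I * (φ x : ℂ)))
    (v' := fun x => Complex.exp (Complex.I * (φ x : ℂ)) * (Complex.I * (φ' x : ℂ)))
    (by rw [uIcc_of_le hab]; exact fun x hx => (hg x hx).ofReal_comp)
    (by rw [uIcc_of_le hab]; exact hv)
    (by
      apply ContinuousOn.intervalIntegrable
      rw [uIcc_of_le hab]
      exact Complex.continuous_ofReal.comp_continuousOn hgc)
    (by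
      apply ContinuousOn.intervalIntegrable
      rw [uIcc_of_le hab]
      exact hexpc.mul (continuousOn_const.mul (Complex.continuous_ofReal.comp_continuousOn hφ'c)))
  have hleft : (∫ x in a..b, (((φ' x)⁻¹ : ℝ) : ℂ) *
      (Complex.exp (Complex.I * (φ x : ℂ)) * (Complex.I * (φ' x : ℂ)))) =
      Complex.I * ∫ x in a..b, Complex.exp (Complex.I * (φ x : ℂ)) := by
    rw [← intervalIntegral.integral_const_mul]
    apply intervalIntegral.integral_congr
    rw [uIcc_of_le hab]
    intro x hx
    have : (φ' x : ℂ) ≠ 0 := by exact_mod_cast hne x hx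
    push_cast
    field_simp
  rw [hleft] at parts
  have hrem : ‖∫ x in a..b, ((-φ'' x / φ' x ^ 2 : ℝ) : ℂ) * Complex.exp (Complex.I * (φ x : ℂ))‖
      ≤ (φ' b)⁻¹ - (φ' a)⁻¹ := by
    have hgi : IntervalIntegrable (fun x => -φ'' x / φ' x ^ 2) volume a b := by
      apply ContinuousOn.intervalIntegrable
      rwa [uIcc_of_le hab]
    rw [← intervalIntegral.integral_eq_sub_of_hasDerivAt (f := fun x => (φ' x)⁻¹)
      (by rw [uIcc_of_le hab]; exact hg) hgi]
    apply intervalIntegral.norm_integral_le_of_norm_le hab _ hgi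
    refine Filter.Eventually.of_forall fun x hx => ?_
    rw [norm_mul, hnorm, mul_one, Complex.norm_real, Real.norm_of_nonneg]
    exact div_nonneg (neg_nonneg.2 (hconc x (Ioc_subset_Icc_self hx))) (sq_nonneg _)
  have hbdry : ∀ x ∈ Icc a b,
      ‖(((φ' x)⁻¹ : ℝ) : ℂ) * Complex.exp (Complex.I * (φ x : ℂ))‖ ≤ 1 / l := fun x hx => by
    rw [norm_mul, hnorm, mul_one, Complex.norm_real]
    exact hginv x hx
  have ha := left_mem_Icc.2 hab
  have hb := right_mem_Icc.2 hab
  calc ‖∫ x in a..b, Complex.exp (Complex.I * (φ x : ℂ))‖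
      = ‖Complex.I * ∫ x in a..b, Complex.exp (Complex.I * (φ x : ℂ))‖ := by simp
    _ ≤ 1 / l + 1 / l + ((φ' b)⁻¹ - (φ' a)⁻¹) := by
      rw [parts]
      exact (norm_sub_le _ _).trans
        (add_le_add ((norm_sub_le _ _).trans (add_le_add (hbdry b hb) (hbdry a ha))) hrem)
    _ ≤ 4 / l := by
      have h1 := (abs_le.1 (hginv b hb)).2
      have h2 := (abs_le.1 (hginv a ha)).1
      have : 4 / l = 4 * (1 / l) := by ring
      linarith

/-- The integrand of `modelKernel`. -/
noncomputable def modelIntegrand (τ y ξ : ℝ) : ℂ :=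
  Complex.exp (-(Complex.I * (y:ℂ) * (ξ:ℂ))) *
    (Complex.exp (-(Complex.I * (τ:ℂ) / ((ξ:ℂ)) ^ 2)) - 1)

theorem norm_exp_neg_I_mul_mul (y ξ : ℝ) :
    ‖Complex.exp (-(Complex.I * (y:ℂ) * (ξ:ℂ)))‖ = 1 := by
  have : -(Complex.I * (y:ℂ) * (ξ:ℂ)) = ((-(y * ξ) : ℝ) : ℂ) * Complex.I := by
    push_cast
    ring
  rw [this, Complex.norm_exp_ofReal_mul_I]

theorem exp_neg_I_mul_div_sq (τ ξ : ℝ) :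
    Complex.exp (-(Complex.I * (τ:ℂ) / ((ξ:ℂ)) ^ 2)) =
      Complex.exp (Complex.I * ((-(τ / ξ ^ 2) : ℝ) : ℂ)) := by
  congr 1
  push_cast
  ring

theorem norm_modelIntegrand_le_two (τ y ξ : ℝ) : ‖modelIntegrand τ y ξ‖ ≤ 2 := by
  rw [modelIntegrand, norm_mul, norm_exp_neg_I_mul_mul, one_mul, exp_neg_I_mul_div_sq]
  refine (norm_sub_le _ _).trans ?_
  rw [mul_comm, Complex.norm_exp_ofReal_mul_I, norm_one]
  norm_num

theorem norm_modelIntegrand_le_div_sq {τ : ℝ} (hτ : 0 ≤ τ) (y ξ : ℝ) :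
    ‖modelIntegrand τ y ξ‖ ≤ τ / ξ ^ 2 := by
  rw [modelIntegrand, norm_mul, norm_exp_neg_I_mul_mul, one_mul, exp_neg_I_mul_div_sq]
  refine Real.norm_exp_I_mul_ofReal_sub_one_le.trans ?_
  rw [norm_neg, Real.norm_of_nonneg (by positivity)]

theorem integrable_modelIntegrand {τ : ℝ} (hτ : 0 ≤ τ) (y : ℝ) :
    Integrable (modelIntegrand τ y) := by
  refine (integrable_inv_one_add_sq.const_mul (2 + τ)).mono' ?_
    (Filter.Eventually.of_forall fun ξ => ?_)
  · apply Measurable.aestronglyMeasurable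
    unfold modelIntegrand
    fun_prop
  · rw [← div_eq_mul_inv, le_div_iff₀ (by positivity)]
    have h2 := norm_modelIntegrand_le_two τ y ξ
    have hd : ‖modelIntegrand τ y ξ‖ * ξ ^ 2 ≤ τ := by
      rcases eq_or_ne ξ 0 with rfl | hξ
      · simpa using hτ
      · exact (le_div_iff₀ (by positivity)).1 (norm_modelIntegrand_le_div_sq hτ y ξ)
    linarith

theorem modelKernel_eq_integral_Ioi_add {τ : ℝ} (hτ : 0 ≤ τ) (y : ℝ) :
    modelKernel τ y =
      (∫ ξ in Ioi (0:ℝ), modelIntegrand τ y ξ) + ∫ ξ in Ioi (0:ℝ), modelIntegrand τ (-y) ξ := by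
  have hi := integrable_modelIntegrand hτ y
  have hneg : (∫ ξ in Ioi (0:ℝ), modelIntegrand τ (-y) ξ) =
      ∫ ξ in Iic (0:ℝ), modelIntegrand τ y ξ := by
    have h := integral_comp_neg_Ioi (0:ℝ) (modelIntegrand τ y)
    rw [neg_zero] at h
    rw [← h]
    congr 1
    ext ξ
    simp [modelIntegrand]
  rw [hneg, add_comm, intervalIntegral.integral_Iic_add_Ioi hi.integrableOn hi.integrableOn]
  rfl

theorem norm_integral_exp_mul_exp_le {τ y a b l : ℝ} (hτ : 0 ≤ τ) (ha : 0 < a) (hab : a ≤ b)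
    (hl : 0 < l) (hlow : ∀ x ∈ Icc a b, l ≤ |-y + 2 * τ / x ^ 3|) :
    ‖∫ ξ in a..b, Complex.exp (-(Complex.I * (y:ℂ) * (ξ:ℂ))) *
      Complex.exp (-(Complex.I * (τ:ℂ) / ((ξ:ℂ)) ^ 2))‖ ≤ 4 / l := by
  have hpos : ∀ x ∈ Icc a b, 0 < x := fun x hx => ha.trans_le hx.1
  have key := norm_integral_exp_phase_le (φ := fun x => -y * x - τ / x ^ 2)
    (φ' := fun x => -y + 2 * τ / x ^ 3) (φ'' := fun x => -(6 * τ / x ^ 4)) hab hl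
    (fun x hx => by
      have hx0 := (hpos x hx).ne'
      have h := ((hasDerivAt_id' x).const_mul (-y)).fun_sub
        ((hasDerivAt_const x τ).fun_div (hasDerivAt_pow 2 x) (pow_ne_zero 2 hx0))
      refine h.congr_deriv ?_
      field_simp
      push_cast
      ring)
    (fun x hx => by
      have hx0 := (hpos x hx).ne'
      have h := ((hasDerivAt_const x (2 * τ)).fun_div (hasDerivAt_pow 3 x)
        (pow_ne_zero 3 hx0)).const_add (-y)
      refine h.congr_deriv ?_
      field_simp
      push_cast
      ring)
    (ContinuousOn.neg (continuousOn_const.div (continuousOn_id.pow 4)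
      fun x hx => pow_ne_zero 4 (hpos x hx).ne'))
    (fun x hx => by
      have := hpos x hx
      have : 0 ≤ 6 * τ / x ^ 4 := by positivity
      linarith)
    hlow
  convert key using 4 with x
  rw [← Complex.exp_add]
  congr 1
  push_cast
  ring

theorem norm_integral_modelIntegrand_le {τ y a b l : ℝ} (hτ : 0 ≤ τ) (ha : 0 < a) (hab : a ≤ b)
    (hl : 0 < l) (hly : l ≤ |y|) (hlow : ∀ x ∈ Icc a b, l ≤ |-y + 2 * τ / x ^ 3|) :
    ‖∫ ξ in a..b, modelIntegrand τ y ξ‖ ≤ 8 / l := by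
  have h1 := norm_integral_exp_mul_exp_le hτ ha hab hl hlow
  have h2 := norm_integral_exp_mul_exp_le (τ := 0) (y := y) le_rfl ha hab hl
    (fun x _ => by simpa using hly)
  have hcont : ∀ t : ℝ, IntervalIntegrable (fun ξ : ℝ =>
      Complex.exp (-(Complex.I * (y:ℂ) * (ξ:ℂ))) *
        Complex.exp (-(Complex.I * (t:ℂ) / ((ξ:ℂ)) ^ 2))) volume a b := fun t => by
    apply ContinuousOn.intervalIntegrable
    rw [uIcc_of_le hab]
    refine ContinuousOn.mul (by fun_prop) (ContinuousOn.cexp (ContinuousOn.neg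
      (ContinuousOn.div (by fun_prop) (by fun_prop) fun x hx => ?_)))
    exact pow_ne_zero 2 (by exact_mod_cast (ha.trans_le hx.1).ne')
  have hsub := intervalIntegral.integral_sub (hcont τ) (hcont 0)
  have heq : ∀ ξ, modelIntegrand τ y ξ = Complex.exp (-(Complex.I * (y:ℂ) * (ξ:ℂ))) *
        Complex.exp (-(Complex.I * (τ:ℂ) / ((ξ:ℂ)) ^ 2)) -
      Complex.exp (-(Complex.I * (y:ℂ) * (ξ:ℂ))) *
        Complex.exp (-(Complex.I * ((0:ℝ):ℂ) / ((ξ:ℂ)) ^ 2)) := fun ξ => by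
    simp [modelIntegrand, mul_sub]
  simp_rw [heq]
  rw [hsub]
  refine (norm_sub_le _ _).trans ((add_le_add h1 h2).trans_eq ?_)
  ring

theorem norm_integral_modelIntegrand_le_two_mul {τ y a b : ℝ} (hab : a ≤ b) :
    ‖∫ ξ in a..b, modelIntegrand τ y ξ‖ ≤ 2 * (b - a) := by
  have := intervalIntegral.norm_integral_le_of_norm_le_const (a := a) (b := b)
    (fun ξ _ => norm_modelIntegrand_le_two τ y ξ)
  rwa [abs_of_nonneg (sub_nonneg.2 hab)] at this

theorem norm_integral_Ioi_modelIntegrand_le {τ y B : ℝ} (hτ : 0 ≤ τ)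
    (hB : ∀ᶠ N in Filter.atTop, ‖∫ ξ in (0:ℝ)..N, modelIntegrand τ y ξ‖ ≤ B) :
    ‖∫ ξ in Ioi (0:ℝ), modelIntegrand τ y ξ‖ ≤ B :=
  le_of_tendsto (intervalIntegral_tendsto_integral_Ioi 0
    (integrable_modelIntegrand hτ y).integrableOn Filter.tendsto_id).norm hB

theorem norm_integral_Ioi_modelIntegrand_le_of_neg {τ y : ℝ} (hτ : 0 ≤ τ) (hy : y < 0) :
    ‖∫ ξ in Ioi (0:ℝ), modelIntegrand τ y ξ‖ ≤ 2 + 8 / |y| := by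
  apply norm_integral_Ioi_modelIntegrand_le hτ
  filter_upwards [Filter.eventually_ge_atTop 1] with N hN
  have hi := fun a b => (integrable_modelIntegrand hτ y).intervalIntegrable (a := a) (b := b)
  rw [← intervalIntegral.integral_add_adjacent_intervals (hi 0 1) (hi 1 N)]
  refine (norm_add_le _ _).trans (add_le_add ?_ ?_)
  · simpa using norm_integral_modelIntegrand_le_two_mul (τ := τ) (y := y) zero_le_one
  · refine norm_integral_modelIntegrand_le hτ one_pos hN (abs_pos.2 hy.ne) le_rfl fun x hx => ?_
    have hx0 : 0 < x := one_pos.trans_le hx.1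
    have : 0 ≤ 2 * τ / x ^ 3 := by positivity
    rw [abs_of_neg hy]
    exact le_trans (by linarith) (le_abs_self _)

/-- Half-line bound in the presence of a stationary point, located at `c`. -/
theorem norm_integral_Ioi_modelIntegrand_le_of_pos {τ y c : ℝ} (hy : 0 < y) (hc : 0 < c)
    (hτc : 2 * τ = y * c ^ 3) :
    ‖∫ ξ in Ioi (0:ℝ), modelIntegrand τ y ξ‖ ≤ 2 + 4 * √c + 16 * (√c + 1) / y := by
  have hτ : 0 ≤ τ := by
    have : 0 < y * c ^ 3 := by positivity
    linarith
  set δ := √c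
  have hδ0 : 0 < δ := Real.sqrt_pos.2 hc
  have hδc : δ ^ 2 = c := Real.sq_sqrt hc.le
  set l := y * (δ / (c + δ)) with hl
  have hl0 : 0 < l := by positivity
  have hl1 : δ / (c + δ) ≤ 1 := (div_le_one (by positivity)).2 (by linarith)
  have hly : l ≤ |y| := by
    rw [abs_of_pos hy]
    exact mul_le_of_le_one_right hy.le hl1
  have hphase : ∀ x : ℝ, -y + 2 * τ / x ^ 3 = y * ((c / x) ^ 3 - 1) := fun x => by
    rw [hτc]
    ring
  have hleft : ∀ x, 0 < x → x ≤ c - δ → l ≤ |-y + 2 * τ / x ^ 3| := fun x hx hxc => by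
    rw [hphase]
    refine le_trans (mul_le_mul_of_nonneg_left ?_ hy.le) (le_abs_self _)
    have h1 : 1 ≤ c / x := (one_le_div hx).2 (by linarith)
    have h2 : c / x ≤ (c / x) ^ 3 := le_self_pow₀ h1 (by norm_num)
    have h3 : δ / (c + δ) ≤ c / x - 1 := by
      rw [div_sub_one hx.ne', div_le_div_iff₀ (by positivity) hx]
      nlinarith
    linarith
  have hright : ∀ x, c + δ ≤ x → l ≤ |-y + 2 * τ / x ^ 3| := fun x hxc => by
    have hx : 0 < x := by linarith
    rw [hphase, abs_mul, abs_of_pos hy]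
    refine mul_le_mul_of_nonneg_left ?_ hy.le
    have h1 : c / x ≤ 1 := (div_le_one hx).2 (by linarith)
    have h2 : (c / x) ^ 3 ≤ c / x := pow_le_of_le_one (by positivity) h1 (by norm_num)
    have h3 : δ / (c + δ) ≤ 1 - c / x := by
      rw [one_sub_div hx.ne', div_le_div_iff₀ (by positivity) hx]
      nlinarith
    rw [abs_sub_comm]
    exact le_trans (by linarith) (le_abs_self _)
  apply norm_integral_Ioi_modelIntegrand_le hτ
  filter_upwards [Filter.eventually_ge_atTop (c + δ)] with N hN
  have hi := fun a b => (integrable_modelIntegrand hτ y).intervalIntegrable (a := a) (b := b)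
  set ε := min 1 c
  have hε0 : 0 < ε := lt_min one_pos hc
  set p := max ε (c - δ) with hp
  have hpc : p ≤ c := max_le (min_le_right _ _) (by linarith)
  have I1 : ‖∫ ξ in (0:ℝ)..ε, modelIntegrand τ y ξ‖ ≤ 2 := by
    refine (norm_integral_modelIntegrand_le_two_mul hε0.le).trans ?_
    have : ε ≤ 1 := min_le_left _ _
    linarith
  have I2 : ‖∫ ξ in ε..p, modelIntegrand τ y ξ‖ ≤ 8 / l := by
    rcases le_total (c - δ) ε with h | h
    · rw [hp, max_eq_left h, intervalIntegral.integral_same, norm_zero]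
      positivity
    · rw [hp, max_eq_right h]
      exact norm_integral_modelIntegrand_le hτ hε0 h hl0 hly
        fun x hx => hleft x (hε0.trans_le hx.1) hx.2
  have I3 : ‖∫ ξ in p..(c + δ), modelIntegrand τ y ξ‖ ≤ 4 * δ := by
    refine (norm_integral_modelIntegrand_le_two_mul (by linarith)).trans ?_
    have : c - δ ≤ p := le_max_right _ _
    linarith
  have I4 : ‖∫ ξ in (c + δ)..N, modelIntegrand τ y ξ‖ ≤ 8 / l :=
    norm_integral_modelIntegrand_le hτ (by positivity) hN hl0 hly fun x hx => hright x hx.1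
  have hl8 : 8 / l = 8 * (δ + 1) / y := by
    rw [hl, ← hδc]
    field_simp
  rw [← intervalIntegral.integral_add_adjacent_intervals (hi 0 (c + δ)) (hi (c + δ) N),
    ← intervalIntegral.integral_add_adjacent_intervals (hi 0 p) (hi p (c + δ)),
    ← intervalIntegral.integral_add_adjacent_intervals (hi 0 ε) (hi ε p)]
  calc _ ≤ 2 + 8 / l + 4 * δ + 8 / l := norm_add_le_of_le
        (norm_add_le_of_le (norm_add_le_of_le I1 I2) I3) I4
    _ = _ := by
      rw [hl8]
      ring

theorem norm_modelKernel_le {τ y c : ℝ} (hy : y ≠ 0) (hc : 0 < c) (hτc : 2 * τ = |y| * c ^ 3) :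
    ‖modelKernel τ y‖ ≤ 2 + 4 * √c + 16 * (√c + 1) / |y| + (2 + 8 / |y|) := by
  have hy0 := abs_pos.2 hy
  have hτ : 0 ≤ τ := by
    have : 0 < |y| * c ^ 3 := by positivity
    linarith
  have hpos := norm_integral_Ioi_modelIntegrand_le_of_pos hy0 hc hτc
  have hneg := norm_integral_Ioi_modelIntegrand_le_of_neg hτ (neg_lt_zero.2 hy0)
  rw [abs_neg, abs_abs] at hneg
  rw [modelKernel_eq_integral_Ioi_add hτ]
  rcases abs_cases y with ⟨h, _⟩ | ⟨h, _⟩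
  · rw [h] at hpos hneg ⊢
    exact norm_add_le_of_le hpos hneg
  · rw [h] at hpos hneg ⊢
    rw [neg_neg] at hneg
    rw [add_comm]
    exact norm_add_le_of_le hpos hneg

theorem modelKernel_bound {y : ℝ} (hy : y ≠ 0) : ∃ C : ℝ, 0 < C ∧ ∀ τ : ℝ, 1 ≤ τ →
    ‖modelKernel τ y‖ ≤ C * τ ^ ((1:ℝ)/6) := by
  have hy0 := abs_pos.2 hy
  set s := (2 / |y|) ^ ((1:ℝ)/6)
  have hs0 : 0 < s := by positivity
  refine ⟨4 + 4 * s + (16 * (s + 1) + 8) / |y|, by positivity, fun τ hτ => ?_⟩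
  have hτ0 : 0 < τ := by linarith
  set t := τ ^ ((1:ℝ)/6)
  have ht1 : 1 ≤ t := Real.one_le_rpow hτ (by norm_num)
  have pow_six : ∀ x : ℝ, 0 < x → (x ^ ((1:ℝ)/6)) ^ 6 = x := fun x hx => by
    rw [← Real.rpow_natCast, ← Real.rpow_mul hx.le]
    norm_num
  have hs6 : s ^ 6 = 2 / |y| := pow_six _ (by positivity)
  have ht6 : t ^ 6 = τ := pow_six _ hτ0
  have hc : 2 * τ = |y| * ((s * t) ^ 2) ^ 3 := by
    rw [← pow_mul, mul_pow]
    norm_num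
    rw [hs6, ht6]
    field_simp
  have key := norm_modelKernel_le hy (by positivity) hc
  rw [Real.sqrt_sq (by positivity)] at key
  refine key.trans ?_
  have e : (4 + 4 * s + (16 * (s + 1) + 8) / |y|) * t -
      (2 + 4 * (s * t) + 16 * (s * t + 1) / |y| + (2 + 8 / |y|)) =
      (4 + 24 / |y|) * (t - 1) := by
    field_simp
    ring
  have : 0 ≤ (4 + 24 / |y|) * (t - 1) := mul_nonneg (by positivity) (by linarith)
  linarith

theorem modelKernel_zero_eq_integral_Ioi : modelKernel 1 0 =
    2 * ∫ u in Ioi (0:ℝ), (Complex.exp (-(Complex.I / ((u:ℂ)) ^ 2)) - 1) := by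
  rw [modelKernel_eq_integral_Ioi_add zero_le_one, neg_zero, ← two_mul]
  simp [modelIntegrand]

theorem modelKernel_zero_scaling {τ : ℝ} (hτ : 0 < τ) :
    modelKernel τ 0 = (√τ : ℂ) * modelKernel 1 0 := by
  have hs : 0 < √τ := Real.sqrt_pos.2 hτ
  have h := Measure.integral_comp_div (modelIntegrand 1 0) (√τ)
  have hcomp : (fun x => modelIntegrand 1 0 (x / √τ)) = modelIntegrand τ 0 := by
    ext x
    have hsq : ((√τ : ℝ) : ℂ) ^ 2 = (τ : ℂ) := by exact_mod_cast Real.sq_sqrt hτ.le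
    simp [modelIntegrand, div_pow, hsq, div_div_eq_mul_div]
  rw [hcomp, abs_of_pos hs, Complex.real_smul] at h
  exact h

theorem modelKernel_one_zero_ne_zero : modelKernel 1 0 ≠ 0 := by
  have hi := integrable_modelIntegrand zero_le_one 0
  have hre : ∀ ξ : ℝ, (modelIntegrand 1 0 ξ).re = Real.cos (1 / ξ ^ 2) - 1 := fun ξ => by
    rw [modelIntegrand, exp_neg_I_mul_div_sq, mul_comm Complex.I ((-(1 / ξ ^ 2) : ℝ) : ℂ)]
    simp only [Complex.ofReal_zero, mul_zero, zero_mul, neg_zero, Complex.exp_zero, one_mul,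
      Complex.sub_re, Complex.exp_ofReal_mul_I_re, Complex.one_re, Real.cos_neg]
  intro h0
  have hint : ∫ ξ, (1 - Real.cos (1 / ξ ^ 2)) = 0 := by
    have h1 : ∫ ξ, (modelIntegrand 1 0 ξ).re = 0 := by
      have := integral_re hi
      simp only [RCLike.re_eq_complex_re] at this
      rw [this]
      exact (congrArg Complex.re h0).trans Complex.zero_re
    simp_rw [hre] at h1
    rw [← neg_eq_zero, ← integral_neg]
    simpa using h1
  have hri : Integrable fun ξ : ℝ => 1 - Real.cos (1 / ξ ^ 2) := by
    have := hi.re.neg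
    refine this.congr (Filter.Eventually.of_forall fun ξ => ?_)
    simp [hre]
  have hnn : ∀ ξ : ℝ, 0 ≤ 1 - Real.cos (1 / ξ ^ 2) := fun ξ => sub_nonneg.2 (Real.cos_le_one _)
  have hae := (integral_eq_zero_iff_of_nonneg hnn hri).1 hint
  have hpos : (0 : ENNReal) < volume (Ioo (1:ℝ) 2) := by simp
  refine hpos.ne' (measure_mono_null (fun ξ hξ => ?_) (ae_iff.1 hae))
  have hξ0 : 0 < ξ := one_pos.trans hξ.1
  have h1 : 1 / ξ ^ 2 ≤ 1 := (div_le_one (by positivity)).2 (one_le_pow₀ hξ.1.le)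
  have hcos : Real.cos (1 / ξ ^ 2) < Real.cos 0 :=
    Real.cos_lt_cos_of_nonneg_of_le_pi le_rfl (by linarith [Real.pi_gt_three]) (by positivity)
  rw [Real.cos_zero] at hcos
  simp only [Pi.zero_apply, mem_ofPred_eq]
  linarith

/-- Pointwise behaviour of the model kernel: (i) for all `τ > 0`,
`K̃_τ(0) = τ^{1/2} K̃_1(0)`, where `K̃_1(0) = 2 ∫₀^∞ (e^{-i/u²} - 1) du ≠ 0`;
(ii) for any fixed `y ≠ 0`, `|K̃_τ(y)| ≤ C τ^{1/6}` for all `τ ≥ 1`. -/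
theorem model_kernel_pointwise :
    (∀ τ : ℝ, 0 < τ → modelKernel τ 0 = (Real.sqrt τ : ℂ) * modelKernel 1 0) ∧
    (modelKernel 1 0 =
      2 * ∫ u in Set.Ioi (0:ℝ), (Complex.exp (-(Complex.I / ((u:ℂ)) ^ 2)) - 1)) ∧
    modelKernel 1 0 ≠ 0 ∧
    (∀ y : ℝ, y ≠ 0 → ∃ C : ℝ, 0 < C ∧ ∀ τ : ℝ, 1 ≤ τ →
      ‖modelKernel τ y‖ ≤ C * τ ^ ((1:ℝ)/6)) := by
  exact ⟨fun _ => modelKernel_zero_scaling, modelKernel_zero_eq_integral_Ioi,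
    modelKernel_one_zero_ne_zero, fun _ => modelKernel_bound⟩
end

section
/- Asymptotics derived from the second-derivative decay of the symbol: let q > 0, ℓ ∈ ℝ, and let p ∈ C²(ℝ) satisfy p(0) = 0, lim_{ξ→+∞} p′(ξ) = 0 and lim_{ξ→+∞} ξ^{q+2} p″(ξ) = ℓ. Then (i) lim_{ξ→+∞} ξ^{q+1} p′(ξ) = −ℓ/(q+1); (ii) p′ is Lebesgue integrable on (0,+∞) and p(ξ) converges, as ξ → +∞, to the finite limit ω₊ := ∫₀^{+∞} p′(ξ) dξ; and (iii) lim_{ξ→+∞} ξ^{q} (ω₊ − p(ξ)) = −ℓ/(q(q+1)). -/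
open Real Filter Topology MeasureTheory Set

/-- If `f → 0` and `x ^ (s + 1) * f' x → ℓ` at `+∞` with `s > 0`, then
`x ^ s * f x → -ℓ / s`. -/
theorem tendsto_rpow_mul_of_tendsto_rpow_mul_deriv {f f' : ℝ → ℝ} {s ℓ : ℝ} (hs : 0 < s)
    (hff' : ∀ᶠ x in atTop, HasDerivAt f (f' x) x) (hf : Tendsto f atTop (𝓝 0))
    (hf' : Tendsto (fun x => x ^ (s + 1) * f' x) atTop (𝓝 ℓ)) :
    Tendsto (fun x => x ^ s * f x) atTop (𝓝 (-ℓ / s)) := by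
  have hlim : Tendsto (fun x => f x / x ^ (-s)) atTop (𝓝 (-ℓ / s)) := by
    refine HasDerivAt.lhopital_zero_atTop (f' := f') (g' := fun x => -s * x ^ (-s - 1))
      hff' ?_ ?_ hf (tendsto_rpow_neg_atTop hs) ((hf'.neg.div_const s).congr' ?_)
    · filter_upwards [eventually_gt_atTop 0] with x hx
      exact hasDerivAt_rpow_const (Or.inl hx.ne')
    · filter_upwards [eventually_gt_atTop 0] with x hx
      exact mul_ne_zero (neg_ne_zero.2 hs.ne') (rpow_pos_of_pos hx _).ne'
    · filter_upwards [eventually_gt_atTop 0] with x hx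
      rw [show -s - 1 = -(s + 1) by ring, rpow_neg hx.le]
      have := (rpow_pos_of_pos hx (s + 1)).ne'
      field_simp
  refine hlim.congr' ?_
  filter_upwards [eventually_gt_atTop 0] with x hx
  rw [rpow_neg hx.le, div_inv_eq_mul, mul_comm]

/-- A continuous function `f` for which `x ^ s * f x` converges at `+∞`, with `s > 1`, is
integrable on every half-line `(a, +∞)`. -/
theorem integrableOn_Ioi_of_tendsto_rpow_mul {f : ℝ → ℝ} {s c : ℝ} (hs : 1 < s)
    (hf : Continuous f) (hlim : Tendsto (fun x => x ^ s * f x) atTop (𝓝 c)) (a : ℝ) :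
    IntegrableOn f (Ioi a) := by
  have hO : f =O[atTop] fun x : ℝ => x ^ (-s) := by
    refine ((Asymptotics.isBigO_refl (fun x : ℝ => x ^ (-s)) atTop).mul
      (hlim.isBigO_one ℝ)).congr' ?_ (by simp)
    filter_upwards [eventually_gt_atTop 0] with x hx
    rw [← mul_assoc, ← rpow_add hx, neg_add_cancel, rpow_zero, one_mul]
  exact ((hf.locallyIntegrable.locallyIntegrableOn (Ici a)).integrableOn_of_isBigO_atTop hO
    (integrableAtFilter_rpow_atTop_iff.2 (neg_lt_neg hs))).mono_set Ioi_subset_Ici_self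

/-- Asymptotics derived from the decay `ξ^{q+2} p''(ξ) → ℓ` of the second
derivative of the symbol: (i) `ξ^{q+1} p'(ξ) → -ℓ/(q+1)`; (ii) `p'` is
integrable on `(0,∞)` and `p` tends at `+∞` to `ω₊ = ∫₀^∞ p'`;
(iii) `ξ^q (ω₊ - p(ξ)) → -ℓ/(q(q+1))`. -/
theorem symbol_asymptotics
    (q ℓ : ℝ) (hq : 0 < q)
    (p : ℝ → ℝ) (hp : ContDiff ℝ 2 p) (hp0 : p 0 = 0)
    (hp' : Tendsto (deriv p) atTop (𝓝 0))
    (hp'' : Tendsto (fun ξ : ℝ => ξ ^ (q + 2) * deriv (deriv p) ξ) atTop (𝓝 ℓ)) :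
    Tendsto (fun ξ : ℝ => ξ ^ (q + 1) * deriv p ξ) atTop (𝓝 (-ℓ / (q + 1))) ∧
    IntegrableOn (deriv p) (Set.Ioi 0) ∧
    Tendsto p atTop (𝓝 (∫ ξ in Set.Ioi (0:ℝ), deriv p ξ)) ∧
    Tendsto (fun ξ : ℝ => ξ ^ q * ((∫ ξ' in Set.Ioi (0:ℝ), deriv p ξ') - p ξ))
      atTop (𝓝 (-ℓ / (q * (q + 1)))) := by
  have hderiv (x : ℝ) : HasDerivAt p (deriv p x) x :=
    (hp.differentiable two_ne_zero x).hasDerivAt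
  have hC1 : ContDiff ℝ 1 (deriv p) :=
    ContDiff.deriv' (by rwa [one_add_one_eq_two])
  have hderiv' (x : ℝ) : HasDerivAt (deriv p) (deriv (deriv p) x) x :=
    (hC1.differentiable one_ne_zero x).hasDerivAt
  have hfirst : Tendsto (fun ξ : ℝ => ξ ^ (q + 1) * deriv p ξ) atTop (𝓝 (-ℓ / (q + 1))) :=
    tendsto_rpow_mul_of_tendsto_rpow_mul_deriv (by positivity) (.of_forall hderiv') hp'
      (by simpa only [add_assoc, one_add_one_eq_two] using hp'')
  have hint : IntegrableOn (deriv p) (Ioi 0) :=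
    integrableOn_Ioi_of_tendsto_rpow_mul (by linarith) hC1.continuous hfirst 0
  have hlim : Tendsto p atTop (𝓝 (∫ ξ in Ioi (0 : ℝ), deriv p ξ)) := by
    refine (intervalIntegral_tendsto_integral_Ioi 0 hint tendsto_id).congr fun x => ?_
    rw [id, intervalIntegral.integral_eq_sub_of_hasDerivAt (fun y _ => hderiv y)
      (hC1.continuous.intervalIntegrable _ _), hp0, sub_zero]
  refine ⟨hfirst, hint, hlim, ?_⟩
  convert tendsto_rpow_mul_of_tendsto_rpow_mul_deriv hq
    (.of_forall fun x => (hderiv x).const_sub (∫ ξ in Ioi (0 : ℝ), deriv p ξ))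
    (by simpa using hlim.const_sub (∫ ξ in Ioi (0 : ℝ), deriv p ξ))
    (by simpa only [mul_neg] using hfirst.neg) using 2
  field_simp
end
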